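/- In the time-averaging setting, assume there exist μ ≥ ‖∇u‖_{L^∞}, N ∈ ℕ and C_N > 0 with: (A1) τμ < 1/2 and (τμ)^{N−1}κ < κ₀; (A2) ‖∇u‖²_{C^n} ≤ C_N(μ/κ)^n μ² for all n ≤ N; (A3) ‖ρ_in‖²_{H^n} ≤ C_N(μ/κ)^n D for all 1 ≤ n ≤ N; (A4) ‖∇ⁿη‖_{L^∞} ≤ C_N(τμ)²(μ/κ)^{n/2} for all 1 ≤ n ≤ N and ‖D^slow_t η‖_{L^∞} ≤ C_N μ. Then there exists a constant C, depending only on N, C_N and ‖η‖_{L^∞}, such that sup_{t≤T} ‖ρ(t) − ρ̄(t)‖²_{L²} + κ∫₀^T ‖∇ρ − ∇ρ̄‖²_{L²} dt ≤ C (τμ)² D, and moreover the total dissipations satisfy |D − D̃| ≤ C (τμ)(D + D̃). -/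

import Mathlib

/-!
STATEMENT 14 (Proposition `p:t_avg`): time averaging of an oscillating diffusivity.
Setting on `T³ × [0,T]` (ℤ³-periodic functions): `κ̃(x,t) = κ₀ + κ₁ η(x,t,τ⁻¹t)`,
`κ = κ₀ + κ₁`; `ρ` solves the oscillating equation and `ρ̄` the averaged one;
`D̃ = ∫₀ᵀ ‖κ̃^{1/2}∇ρ‖²`, `D = κ∫₀ᵀ ‖∇ρ̄‖²`.  `D_t^slow` acts in the slow variables.
`μ ≥ ‖∇u‖_{L∞}` is expressed pointwise.  The functions η(x,t,s) are written `η t x s`.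
-/

open MeasureTheory Real Set Filter

noncomputable section

abbrev Ed (d : ℕ) : Type := EuclideanSpace ℝ (Fin d)
abbrev E3 : Type := Ed 3

def cube (d : ℕ) : Set (Ed d) := {x : Ed d | ∀ i, 0 ≤ x i ∧ x i < 1}

def SpacePeriodic {d : ℕ} {α : Type*} (f : Ed d → α) : Prop :=
  ∀ (x : Ed d) (m : Fin d → ℤ),
    f (x + ∑ i, (m i : ℝ) • EuclideanSpace.single i (1:ℝ)) = f x

def spd {d : ℕ} (i : Fin d) (f : Ed d → ℝ) (x : Ed d) : ℝ :=
  fderiv ℝ f x (EuclideanSpace.single i (1:ℝ))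

def divg {d : ℕ} (u : Ed d → Ed d) (x : Ed d) : ℝ :=
  ∑ i, spd i (fun y => u y i) x

def lapl {d : ℕ} (f : Ed d → ℝ) (x : Ed d) : ℝ :=
  ∑ i, spd i (spd i f) x

def L2sq {d : ℕ} (f : Ed d → ℝ) : ℝ := ∫ x in cube d, (f x) ^ 2

def SmoothTS {d : ℕ} {F : Type*} [NormedAddCommGroup F] [NormedSpace ℝ F]
    (f : ℝ → Ed d → F) : Prop :=
  ContDiff ℝ (⊤ : ℕ∞) (fun p : ℝ × Ed d => f p.1 p.2)

/-- squared Hⁿ norm on the torus -/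
def HnormSq {d : ℕ} (n : ℕ) (f : Ed d → ℝ) : ℝ :=
  ∑ m ∈ Finset.range (n+1), ∫ x in cube d, ‖iteratedFDeriv ℝ m f x‖ ^ 2

/-! ### Integrals depending smoothly on a parameter -/

section Parametric

variable {E α : Type} [NormedAddCommGroup E] [NormedSpace ℝ E] [ProperSpace E]
  [TopologicalSpace α] [SecondCountableTopology α] [MeasurableSpace α] [OpensMeasurableSpace α]
  {ν : Measure α} [IsFiniteMeasure ν] {k : Set α}

lemma integrable_of_continuous_of_compact {F : Type} [NormedAddCommGroup F]
    (hk : IsCompact k) (hν : ∀ᵐ a ∂ν, a ∈ k) {g : α → F} (hg : Continuous g) :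
    Integrable g ν := by
  obtain ⟨c, hc⟩ := hk.exists_bound_of_continuousOn hg.continuousOn
  exact Integrable.of_bound hg.aestronglyMeasurable c (hν.mono fun a ha => hc a ha)

lemma hasFDerivAt_integral_of_compact {F : Type} [NormedAddCommGroup F] [NormedSpace ℝ F]
    (hk : IsCompact k) (hν : ∀ᵐ a ∂ν, a ∈ k) {G : E → α → F} {G' : E → α → E →L[ℝ] F}
    (hG : Continuous (fun q : E × α => G q.1 q.2))
    (hG' : Continuous (fun q : E × α => G' q.1 q.2))
    (hd : ∀ p a, HasFDerivAt (fun p => G p a) (G' p a) p) (p : E) :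
    HasFDerivAt (fun p => ∫ a, G p a ∂ν) (∫ a, G' p a ∂ν) p := by
  have cont : ∀ q : E, Continuous (fun a : α => (q, a)) := fun q => by fun_prop
  obtain ⟨c, hc⟩ := ((isCompact_closedBall p 1).prod hk).exists_bound_of_continuousOn
    hG'.continuousOn
  refine hasFDerivAt_integral_of_dominated_of_fderiv_le (bound := fun _ => c)
    (Metric.closedBall_mem_nhds p one_pos)
    (Eventually.of_forall fun q => (hG.comp (cont q)).aestronglyMeasurable)
    (integrable_of_continuous_of_compact hk hν (hG.comp (cont p)))
    (hG'.comp (cont p)).aestronglyMeasurable ?_ (integrable_const c)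
    (Eventually.of_forall fun a q _ => hd q a)
  exact hν.mono fun a ha q hq => hc (q, a) ⟨hq, ha⟩

lemma continuous_integral_of_compact {F : Type} [NormedAddCommGroup F] [NormedSpace ℝ F]
    (hk : IsCompact k) (hν : ∀ᵐ a ∂ν, a ∈ k) {G : E → α → F}
    (hG : Continuous (fun q : E × α => G q.1 q.2)) :
    Continuous (fun p => ∫ a, G p a ∂ν) := by
  have cont : ∀ q : E, Continuous (fun a : α => (q, a)) := fun q => by fun_prop
  rw [continuous_iff_continuousAt]
  intro p
  obtain ⟨c, hc⟩ := ((isCompact_closedBall p 1).prod hk).exists_bound_of_continuousOn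
    hG.continuousOn
  refine continuousAt_of_dominated (bound := fun _ => c)
    (Eventually.of_forall fun q => (hG.comp (cont q)).aestronglyMeasurable) ?_
    (integrable_const c) (Eventually.of_forall fun a => ?_)
  · filter_upwards [Metric.closedBall_mem_nhds p one_pos] with q hq
    exact hν.mono fun a ha => hc (q, a) ⟨hq, ha⟩
  · have : Continuous (fun q : E => (q, a)) := by fun_prop
    exact (hG.comp this).continuousAt

end Parametric

section ParametricSmooth

variable {E α : Type} [NormedAddCommGroup E] [NormedSpace ℝ E] [ProperSpace E]
  [NormedAddCommGroup α] [NormedSpace ℝ α] [SecondCountableTopology α] [MeasurableSpace α]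
  [OpensMeasurableSpace α] {ν : Measure α} [IsFiniteMeasure ν] {k : Set α}

lemma hasFDerivAt_fst_slice {F : Type} [NormedAddCommGroup F] [NormedSpace ℝ F]
    {G : E × α → F} (hG : ContDiff ℝ 1 G) (p : E) (a : α) :
    HasFDerivAt (fun p => G (p, a)) ((fderiv ℝ G (p, a)).comp (ContinuousLinearMap.inl ℝ E α))
      p :=
  ((hG.differentiable one_ne_zero (p, a)).hasFDerivAt).comp p (hasFDerivAt_prodMk_left p a)

lemma contDiff_integral_of_compact (hk : IsCompact k) (hν : ∀ᵐ a ∂ν, a ∈ k) (n : ℕ) :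
    ∀ {F : Type} [NormedAddCommGroup F] [NormedSpace ℝ F] {G : E × α → F},
      ContDiff ℝ (⊤ : ℕ∞) G → ContDiff ℝ n (fun p => ∫ a, G (p, a) ∂ν) := by
  induction n with
  | zero =>
    intro F _ _ G hG
    exact contDiff_zero.2 (continuous_integral_of_compact hk hν (G := fun p a => G (p, a))
      hG.continuous)
  | succ n ih =>
    intro F _ _ G hG
    have h1 : ContDiff ℝ 1 G := hG.of_le (by exact_mod_cast le_top)
    have hG' : ContDiff ℝ (⊤ : ℕ∞)
        (fun q : E × α => (fderiv ℝ G q).comp (ContinuousLinearMap.inl ℝ E α)) :=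
      (hG.fderiv_right (m := (⊤ : ℕ∞)) (by simp)).clm_comp contDiff_const
    have hd := fun p => hasFDerivAt_integral_of_compact hk hν (G := fun p a => G (p, a))
      (G' := fun p a => (fderiv ℝ G (p, a)).comp (ContinuousLinearMap.inl ℝ E α))
      hG.continuous hG'.continuous (fun p a => hasFDerivAt_fst_slice h1 p a) p
    rw [show ((n + 1 : ℕ) : WithTop ℕ∞) = (n : WithTop ℕ∞) + 1 by push_cast; rfl,
      contDiff_succ_iff_hasFDerivAt]
    exact ⟨_, ih hG', hd⟩

end ParametricSmooth


/-! ### The algebra of smooth space-periodic functions -/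

/-- Smooth functions of time and space which are periodic in space. -/
def SP : Subalgebra ℝ (ℝ → E3 → ℝ) where
  carrier := {f | SmoothTS f ∧ ∀ t, SpacePeriodic (f t)}
  mul_mem' := fun {f g} hf hg =>
    ⟨ContDiff.mul hf.1 hg.1, fun t x m => by simp [hf.2 t x m, hg.2 t x m]⟩
  add_mem' := fun {f g} hf hg =>
    ⟨ContDiff.add hf.1 hg.1, fun t x m => by simp [hf.2 t x m, hg.2 t x m]⟩
  algebraMap_mem' := fun r => ⟨contDiff_const, fun _ _ _ => rfl⟩

/-- The uncurried function. -/
def unc (f : SP) (p : ℝ × E3) : ℝ := f.1 p.1 p.2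

lemma contDiff_unc (f : SP) : ContDiff ℝ (⊤ : ℕ∞) (unc f) := f.2.1

lemma differentiable_unc (f : SP) : Differentiable ℝ (unc f) := (contDiff_unc f).differentiable (by simp)

/-- Evaluation at a point. -/
def ev (t : ℝ) (x : E3) : SP →ₐ[ℝ] ℝ :=
  (Pi.evalAlgHom ℝ (fun _ : E3 => ℝ) x).comp
    ((Pi.evalAlgHom ℝ (fun _ : ℝ => E3 → ℝ) t).comp SP.val)

lemma ev_eq (t : ℝ) (x : E3) (f : SP) : ev t x f = f.1 t x := rfl

lemma ext_ev {f g : SP} (h : ∀ t x, ev t x f = ev t x g) : f = g :=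
  Subtype.ext (funext fun t => funext fun x => h t x)

lemma unc_periodic (f : SP) (p : ℝ × E3) (m : Fin 3 → ℤ) :
    (unc f) (p + ((0 : ℝ), ∑ i, (m i : ℝ) • EuclideanSpace.single i (1:ℝ))) = (unc f) p := by
  simpa [unc] using f.2.2 p.1 p.2 m

/-- The directional derivative along a constant space-time vector. -/
def dirFun (v : ℝ × E3) (f : SP) : SP :=
  ⟨fun t x => fderiv ℝ (unc f) (t, x) v, by
    constructor
    · exact ((contDiff_unc f).fderiv_right (m := (⊤ : ℕ∞)) (by simp)).clm_apply contDiff_const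
    · intro t x m
      have h : (fun p => (unc f) (p + ((0 : ℝ), ∑ i, (m i : ℝ) • EuclideanSpace.single i (1:ℝ))))
          = (unc f) := funext fun p => unc_periodic f p m
      have h2 := fderiv_comp_add_right (𝕜 := ℝ) (f := (unc f)) (x := (t, x))
        ((0 : ℝ), ∑ i, (m i : ℝ) • EuclideanSpace.single i (1:ℝ))
      rw [h] at h2
      simp only [h2, Prod.mk_add_mk, add_zero]⟩

lemma ev_dirFun (v : ℝ × E3) (f : SP) (t : ℝ) (x : E3) :
    ev t x (dirFun v f) = fderiv ℝ (unc f) (t, x) v := rfl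

/-- The directional derivative along a constant space-time vector, as a derivation. -/
def dir (v : ℝ × E3) : Derivation ℝ SP SP :=
  Derivation.mk'
    { toFun := dirFun v
      map_add' := fun f g => ext_ev fun t x => by
        rw [map_add, ev_dirFun, ev_dirFun, ev_dirFun,
          show unc (f + g) = (unc f) + (unc g) from rfl,
          fderiv_add (differentiable_unc f _) (differentiable_unc g _)]
        rfl
      map_smul' := fun c f => ext_ev fun t x => by
        rw [map_smul, ev_dirFun, ev_dirFun, show unc (c • f) = c • unc f from rfl,
          fderiv_const_smul (differentiable_unc f _)]
        rfl }
    (fun f g => ext_ev fun t x => by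
      simp only [LinearMap.coe_mk, AddHom.coe_mk, smul_eq_mul, map_add, map_mul]
      rw [ev_dirFun, ev_dirFun, ev_dirFun, show unc (f * g) = (unc f) * (unc g) from rfl,
          fderiv_mul (differentiable_unc f _) (differentiable_unc g _)]
      simp [unc, ev_eq])

lemma ev_dir (v : ℝ × E3) (f : SP) (t : ℝ) (x : E3) :
    ev t x (dir v f) = fderiv ℝ (unc f) (t, x) v := rfl

lemma dir_comm (v w : ℝ × E3) (f : SP) : dir v (dir w f) = dir w (dir v f) := by
  refine ext_ev fun t x => ?_
  have key : ∀ a b : ℝ × E3, ev t x (dir a (dir b f)) = fderiv ℝ (fderiv ℝ (unc f)) (t, x) a b := by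
    intro a b
    have hd : DifferentiableAt ℝ (fderiv ℝ (unc f)) (t, x) :=
      ((contDiff_unc f).fderiv_right (m := (⊤ : ℕ∞)) (by simp)).differentiable (by simp) _
    rw [ev_dir, show unc (dir b f) = fun p => fderiv ℝ (unc f) p b from rfl,
      fderiv_clm_apply hd (by fun_prop)]
    simp
  rw [key, key]
  exact ((contDiff_unc f).contDiffAt.isSymmSndFDerivAt
    (by
      rw [minSmoothness_of_isRCLikeNormedField]
      exact WithTop.coe_le_coe.2 (le_top : (2 : ℕ∞) ≤ ⊤))).eq v w

/-- Time derivative. -/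
def td : Derivation ℝ SP SP := dir (1, 0)

/-- Partial derivative in space. -/
def pd (i : Fin 3) : Derivation ℝ SP SP := dir (0, EuclideanSpace.single i (1:ℝ))

lemma pd_comm (i j : Fin 3) (f : SP) : pd i (pd j f) = pd j (pd i f) := dir_comm _ _ _

lemma pd_td (i : Fin 3) (f : SP) : pd i (td f) = td (pd i f) := dir_comm _ _ _

lemma hasDerivAt_td (f : SP) (t : ℝ) (x : E3) :
    HasDerivAt (fun s => ev s x f) (ev t x (td f)) t := by
  have h := (differentiable_unc f (t, x)).hasFDerivAt.comp_hasDerivAt t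
    ((hasDerivAt_id t).prodMk (hasDerivAt_const t x))
  exact h

lemma hasFDerivAt_slice (f : SP) (t : ℝ) (x : E3) :
    HasFDerivAt (f.1 t) ((fderiv ℝ (unc f) (t, x)).comp (ContinuousLinearMap.inr ℝ ℝ E3)) x :=
  (differentiable_unc f (t, x)).hasFDerivAt.comp x (hasFDerivAt_prodMk_right t x)

lemma spd_eq (i : Fin 3) (f : SP) (t : ℝ) : spd i (f.1 t) = (pd i f).1 t := by
  funext x
  rw [spd, (hasFDerivAt_slice f t x).fderiv]
  rfl

lemma contDiff_slice (f : SP) (t : ℝ) : ContDiff ℝ (⊤ : ℕ∞) (f.1 t) :=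
  (contDiff_unc f).comp (contDiff_prodMk_right t)

/-- A function vanishing on a time slice has vanishing space derivatives there. -/
lemma ev_pd_eq_zero {f : SP} {t : ℝ} (h : ∀ x, ev t x f = 0) (i : Fin 3) (x : E3) :
    ev t x (pd i f) = 0 := by
  have h0 : f.1 t = fun _ => 0 := funext h
  rw [ev_eq, ← spd_eq, h0]
  simp [spd]

/-! ### Integration over the torus -/

lemma measurableSet_cube : MeasurableSet (cube 3) := by
  have : cube 3 = ⋂ i, {x : E3 | 0 ≤ x i ∧ x i < 1} := by ext; simp [cube]
  rw [this]
  refine MeasurableSet.iInter fun i => ?_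
  have hm : Measurable fun x : E3 => x i := by fun_prop
  exact (measurableSet_le measurable_const hm).inter (measurableSet_lt hm measurable_const)

/-- The closed unit cube. -/
def ccube : Set E3 := (WithLp.ofLp : E3 → Fin 3 → ℝ) ⁻¹' Icc 0 1

lemma isCompact_ccube : IsCompact ccube :=
  (PiLp.homeomorph 2 (fun _ : Fin 3 => ℝ)).isCompact_preimage.2 isCompact_Icc

lemma cube_subset_ccube : cube 3 ⊆ ccube := fun _ hx =>
  ⟨fun i => (hx i).1, fun i => (hx i).2.le⟩

instance : IsFiniteMeasure ((volume : Measure E3).restrict (cube 3)) :=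
  ⟨by
    rw [Measure.restrict_apply_univ]
    exact (measure_mono cube_subset_ccube).trans_lt isCompact_ccube.measure_lt_top⟩

lemma ae_mem_ccube : ∀ᵐ x ∂((volume : Measure E3).restrict (cube 3)), x ∈ ccube :=
  (ae_restrict_mem measurableSet_cube).mono fun _ hx => cube_subset_ccube hx

lemma integrable_slice (f : SP) (t : ℝ) : IntegrableOn (f.1 t) (cube 3) :=
  integrable_of_continuous_of_compact isCompact_ccube ae_mem_ccube (contDiff_slice f t).continuous

/-- The integral over the torus at a fixed time. -/
def Int3 (t : ℝ) : SP →ₗ[ℝ] ℝ where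
  toFun f := ∫ x in cube 3, ev t x f
  map_add' f g := by
    simp only [map_add]
    exact integral_add (integrable_slice f t) (integrable_slice g t)
  map_smul' c f := by
    simp only [map_smul]
    exact integral_smul c _

lemma Int3_eq (t : ℝ) (f : SP) : Int3 t f = ∫ x in cube 3, f.1 t x := rfl

lemma Int3_mono {t : ℝ} {f g : SP} (h : ∀ x, ev t x f ≤ ev t x g) : Int3 t f ≤ Int3 t g :=
  integral_mono (integrable_slice f t) (integrable_slice g t) h

lemma hasDerivAt_Int3 (f : SP) (t : ℝ) :
    HasDerivAt (fun s => Int3 s f) (Int3 t (td f)) t := by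
  have h1 : ContDiff ℝ 1 (unc f) := (contDiff_unc f).of_le (by exact_mod_cast le_top)
  have hG' : Continuous (fun q : ℝ × E3 =>
      (fderiv ℝ (unc f) q).comp (ContinuousLinearMap.inl ℝ ℝ E3)) :=
    ((h1.continuous_fderiv one_ne_zero)).clm_comp continuous_const
  have h := hasFDerivAt_integral_of_compact isCompact_ccube ae_mem_ccube
    (G := fun t x => (unc f) (t, x))
    (G' := fun t x => (fderiv ℝ (unc f) (t, x)).comp (ContinuousLinearMap.inl ℝ ℝ E3))
    (contDiff_unc f).continuous hG' (fun p a => hasFDerivAt_fst_slice h1 p a) t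
  have h2 := h.hasDerivAt
  rw [ContinuousLinearMap.integral_apply] at h2
  · exact h2
  · exact integrable_of_continuous_of_compact isCompact_ccube ae_mem_ccube
      (hG'.comp (by fun_prop : Continuous fun x : E3 => (t, x)))

lemma continuous_Int3 (f : SP) : Continuous fun t => Int3 t f :=
  continuous_iff_continuousAt.2 fun t => (hasDerivAt_Int3 f t).continuousAt

lemma setIntegral_cube (g : E3 → ℝ) :
    ∫ x in cube 3, g x = ∫ y in Icc (0 : Fin 3 → ℝ) 1, g (WithLp.toLp 2 y) := by
  have h1 : cube 3 = (WithLp.ofLp : E3 → Fin 3 → ℝ) ⁻¹' (univ.pi fun _ => Ico 0 1) := by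
    ext; simp [cube]
  have h2 := (PiLp.volume_preserving_ofLp (Fin 3)).setIntegral_preimage_emb
    (MeasurableEquiv.toLp 2 (Fin 3 → ℝ)).symm.measurableEmbedding
    (fun y => g (WithLp.toLp 2 y)) (univ.pi fun _ => Ico 0 1)
  rw [h1]
  refine h2.trans (setIntegral_congr_set ?_)
  exact Measure.univ_pi_Ico_ae_eq_Icc

lemma Int3_pd (t : ℝ) (i : Fin 3) (f : SP) : Int3 t (pd i f) = 0 := by
  rw [Int3_eq, setIntegral_cube]
  have h1 : ContDiff ℝ 1 (f.1 t) := (contDiff_slice f t).of_le (by exact_mod_cast le_top)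
  have hL : ∀ y : Fin 3 → ℝ, HasFDerivAt (fun y : Fin 3 → ℝ => f.1 t (WithLp.toLp 2 y))
      ((fderiv ℝ (f.1 t) (WithLp.toLp 2 y)).comp
        ((PiLp.continuousLinearEquiv 2 ℝ (fun _ : Fin 3 => ℝ)).symm :
          (Fin 3 → ℝ) →L[ℝ] E3)) y := fun y =>
    ((h1.differentiable one_ne_zero (WithLp.toLp 2 y)).hasFDerivAt).comp y
      (PiLp.continuousLinearEquiv 2 ℝ (fun _ : Fin 3 => ℝ)).symm.hasFDerivAt
  have hcont : Continuous fun y : Fin 3 → ℝ => f.1 t (WithLp.toLp 2 y) :=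
    continuous_iff_continuousAt.2 fun y => (hL y).continuousAt
  have hval : ∀ y : Fin 3 → ℝ, ∑ j, (if j = i then
      (fderiv ℝ (f.1 t) (WithLp.toLp 2 y)).comp
        ((PiLp.continuousLinearEquiv 2 ℝ (fun _ : Fin 3 => ℝ)).symm :
          (Fin 3 → ℝ) →L[ℝ] E3) else 0) (Pi.single j 1) = (pd i f).1 t (WithLp.toLp 2 y) := by
    intro y
    rw [← spd_eq, spd, Finset.sum_eq_single i (fun j _ hj => by simp [hj]) (by simp)]
    simp only [if_true]
    rfl
  have key := integral_divergence_of_hasFDerivAt_off_countable' (n := 2) (E := ℝ)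
    (a := 0) (b := 1) (fun _ => zero_le_one)
    (f := fun j y => if j = i then f.1 t (WithLp.toLp 2 y) else 0)
    (f' := fun j y => if j = i then (fderiv ℝ (f.1 t) (WithLp.toLp 2 y)).comp
        ((PiLp.continuousLinearEquiv 2 ℝ (fun _ : Fin 3 => ℝ)).symm :
          (Fin 3 → ℝ) →L[ℝ] E3) else 0) ∅ Set.countable_empty
    (fun j => by
      by_cases hj : j = i
      · simpa [hj] using hcont.continuousOn
      · simpa [hj] using continuousOn_const)
    (fun y _ j => by
      by_cases hj : j = i
      · simpa [hj] using hL y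
      · simpa [hj] using hasFDerivAt_const (0 : ℝ) y)
    (by
      simp only [hval]
      exact (((contDiff_slice (pd i f) t).continuous.comp
        (PiLp.continuous_toLp 2 _)).continuousOn).integrableOn_compact isCompact_Icc)
  simp only [hval] at key
  rw [key]
  refine Finset.sum_eq_zero fun j _ => ?_
  by_cases hj : j = i
  · subst hj
    rw [sub_eq_zero]
    refine integral_congr_ae (Eventually.of_forall fun z => ?_)
    simp only [if_true]
    have := f.2.2 t (WithLp.toLp 2 (j.insertNth (0 : ℝ) z)) (Pi.single j 1)
    rw [show WithLp.toLp 2 (j.insertNth (0 : ℝ) z) + ∑ i, ((Pi.single j 1 : Fin 3 → ℤ) i : ℝ) •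
        EuclideanSpace.single i (1 : ℝ) = WithLp.toLp 2 (j.insertNth (1 : ℝ) z) from ?_] at this
    · exact this
    · rw [Finset.sum_eq_single j (fun b _ hb => by simp [hb]) (by simp)]
      ext k
      rcases Fin.eq_self_or_eq_succAbove j k with rfl | ⟨k, rfl⟩ <;>
        simp
  · simp [hj]

/-! ### Space-time integrals and the energy identity -/

/-- Constant functions. -/
def cst (c : ℝ) : SP := algebraMap ℝ SP c

@[simp] lemma ev_cst (t : ℝ) (x : E3) (c : ℝ) : ev t x (cst c) = c := rfl

@[simp] lemma pd_cst (i : Fin 3) (c : ℝ) : pd i (cst c) = 0 := (pd i).map_algebraMap c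

@[simp] lemma td_cst (c : ℝ) : td (cst c) = 0 := td.map_algebraMap c

lemma cst_mul (c : ℝ) (f : SP) : cst c * f = c • f := (Algebra.smul_def c f).symm

/-- The integral over the torus and the time interval from `0` to `t`. -/
def II (t : ℝ) : SP →ₗ[ℝ] ℝ where
  toFun f := ∫ s in (0:ℝ)..t, Int3 s f
  map_add' f g := by
    simp only [map_add]
    exact intervalIntegral.integral_add ((continuous_Int3 f).intervalIntegrable _ _)
      ((continuous_Int3 g).intervalIntegrable _ _)
  map_smul' c f := by
    simp only [map_smul]
    exact intervalIntegral.integral_smul c _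

lemma II_eq (t : ℝ) (f : SP) : II t f = ∫ s in (0:ℝ)..t, Int3 s f := rfl

@[simp] lemma II_cst_mul (t c : ℝ) (f : SP) : II t (cst c * f) = c * II t f := by
  rw [cst_mul, map_smul, smul_eq_mul]

@[simp] lemma Int3_cst_mul (t c : ℝ) (f : SP) : Int3 t (cst c * f) = c * Int3 t f := by
  rw [cst_mul, map_smul, smul_eq_mul]

lemma II_mono {t : ℝ} (ht : 0 ≤ t) {f g : SP}
    (h : ∀ s ∈ Icc (0:ℝ) t, ∀ x, ev s x f ≤ ev s x g) : II t f ≤ II t g :=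
  intervalIntegral.integral_mono_on ht ((continuous_Int3 f).intervalIntegrable _ _)
    ((continuous_Int3 g).intervalIntegrable _ _) fun s hs => Int3_mono (h s hs)

lemma II_nonneg {t : ℝ} (ht : 0 ≤ t) {f : SP}
    (h : ∀ s ∈ Icc (0:ℝ) t, ∀ x, 0 ≤ ev s x f) : 0 ≤ II t f := by
  simpa using II_mono (f := 0) ht (by simpa using h)

lemma Int3_nonneg {t : ℝ} {f : SP} (h : ∀ x, 0 ≤ ev t x f) : 0 ≤ Int3 t f := by
  simpa using Int3_mono (f := 0) (by simpa using h)

lemma II_mono_time {t T : ℝ} (ht : t ∈ Icc 0 T) {f : SP}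
    (h : ∀ s ∈ Icc (0:ℝ) T, ∀ x, 0 ≤ ev s x f) : II t f ≤ II T f := by
  have hi := fun a b => (continuous_Int3 f).intervalIntegrable (μ := volume) a b
  rw [II_eq, II_eq, ← intervalIntegral.integral_add_adjacent_intervals (hi 0 t) (hi t T)]
  have : 0 ≤ ∫ s in t..T, Int3 s f := intervalIntegral.integral_nonneg ht.2 fun s hs =>
    Int3_nonneg (h s ⟨ht.1.trans hs.1, hs.2⟩)
  linarith

lemma Int3_eq_add_II (t : ℝ) (f : SP) : Int3 t f = Int3 0 f + II t (td f) := by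
  rw [II_eq, intervalIntegral.integral_eq_sub_of_hasDerivAt (fun s _ => hasDerivAt_Int3 f s)
    ((continuous_Int3 (td f)).intervalIntegrable _ _)]
  ring

/-- The material derivative. -/
def Dm (u : Fin 3 → SP) (φ : SP) : SP := td φ + ∑ j, u j * pd j φ

/-- `φ` solves `Dₜφ = div Q + g` on `[0,T]`. -/
def Sol (u : Fin 3 → SP) (T : ℝ) (φ : SP) (Q : Fin 3 → SP) (g : SP) : Prop :=
  ∀ t ∈ Icc (0:ℝ) T, ∀ x, ev t x (Dm u φ) = ev t x (∑ j, pd j (Q j) + g)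

lemma Dm_mul (u : Fin 3 → SP) (f g : SP) : Dm u (f * g) = f * Dm u g + g * Dm u f := by
  simp only [Dm, Derivation.leibniz, smul_eq_mul, Fin.sum_univ_three]
  ring

lemma Dm_pd (u : Fin 3 → SP) (i : Fin 3) (φ : SP) :
    Dm u (pd i φ) = pd i (Dm u φ) - ∑ j, pd i (u j) * pd j φ := by
  simp only [Dm, map_add, Derivation.leibniz, smul_eq_mul, Fin.sum_univ_three, pd_td,
    pd_comm i]
  ring

lemma Sol.pd {u : Fin 3 → SP} {T : ℝ} {φ : SP} {Q : Fin 3 → SP} {g : SP}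
    (h : Sol u T φ Q g) (i : Fin 3) :
    Sol u T (pd i φ) (fun j => pd i (Q j)) (pd i g - ∑ j, pd i (u j) * pd j φ) := by
  intro t ht x
  have h0 := ev_pd_eq_zero (f := Dm u φ - (∑ j, _root_.pd j (Q j) + g)) (t := t)
    (fun x => by rw [map_sub, h t ht x, sub_self]) i x
  rw [Dm_pd]
  simp only [map_sub, map_add, map_sum] at h0 ⊢
  simp only [pd_comm i] at h0
  linarith

lemma II_div (t : ℝ) (Q : Fin 3 → SP) : II t (∑ j, pd j (Q j)) = 0 := by
  rw [map_sum]
  exact Finset.sum_eq_zero fun j _ => by simp only [II_eq, Int3_pd, intervalIntegral.integral_zero]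

lemma II_Dm {u : Fin 3 → SP} (hu : ∑ j, pd j (u j) = 0) (t : ℝ) (f : SP) :
    Int3 t f = Int3 0 f + II t (Dm u f) := by
  have h : Dm u f = td f + ∑ j, pd j (u j * f) := by
    have : ∑ j, pd j (u j * f) = ∑ j, u j * pd j f + f * ∑ j, pd j (u j) := by
      simp only [Derivation.leibniz, smul_eq_mul, Fin.sum_univ_three]
      ring
    rw [this, hu, Dm]
    ring
  rw [h, map_add, Int3_eq_add_II]
  rw [II_div, add_zero]

lemma energy {u : Fin 3 → SP} (hu : ∑ j, pd j (u j) = 0) {T : ℝ} {φ g : SP} {Q : Fin 3 → SP}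
    (h : Sol u T φ Q g) (W : SP) {t : ℝ} (ht : t ∈ Icc 0 T) :
    Int3 t (W * (φ * φ)) = Int3 0 (W * (φ * φ)) + II t (Dm u W * (φ * φ)
      - cst 2 * ∑ j, pd j (W * φ) * Q j + cst 2 * (W * φ * g)) := by
  rw [II_Dm hu]
  congr 1
  have h1 : II t (Dm u (W * (φ * φ))) = II t (Dm u W * (φ * φ)
      + cst 2 * (W * φ * (∑ j, pd j (Q j) + g))) := by
    refine le_antisymm ?_ ?_ <;> refine II_mono ht.1 fun s hs x => le_of_eq ?_ <;>
    · have := h s ⟨hs.1, hs.2.trans ht.2⟩ x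
      simp only [Dm_mul, map_add, map_mul, ev_cst] at this ⊢
      rw [this]
      ring
  have h2 : Dm u W * (φ * φ) + cst 2 * (W * φ * (∑ j, pd j (Q j) + g))
      = (Dm u W * (φ * φ) - cst 2 * ∑ j, pd j (W * φ) * Q j + cst 2 * (W * φ * g))
        + ∑ j, pd j (cst 2 * (W * φ * Q j)) := by
    simp only [Derivation.leibniz, smul_eq_mul, Fin.sum_univ_three, pd_cst]
    ring
  rw [h1, h2, map_add, II_div, add_zero]

lemma energy_one {u : Fin 3 → SP} (hu : ∑ j, pd j (u j) = 0) {T : ℝ} {φ g : SP}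
    {Q : Fin 3 → SP} (h : Sol u T φ Q g) {t : ℝ} (ht : t ∈ Icc 0 T) :
    Int3 t (φ * φ) = Int3 0 (φ * φ) + II t (cst 2 * (φ * g) - cst 2 * ∑ j, pd j φ * Q j) := by
  have := energy hu h 1 ht
  have h1 : Dm u 1 = 0 := by simp [Dm]
  rw [h1] at this
  simp only [one_mul, zero_mul] at this
  rw [this]
  congr 2
  ring

/-- The squared length of the gradient. -/
def N1 (φ : SP) : SP := ∑ i, pd i φ * pd i φ

/-- The squared length of the second derivative. -/
def N2 (φ : SP) : SP := ∑ i, N1 (pd i φ)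

/-- The squared length of the third derivative. -/
def N3 (φ : SP) : SP := ∑ i, N2 (pd i φ)

lemma ev_N1 (t : ℝ) (x : E3) (φ : SP) : ev t x (N1 φ) = ∑ i, (ev t x (pd i φ)) ^ 2 := by
  simp [N1, sq]

lemma ev_N2 (t : ℝ) (x : E3) (φ : SP) :
    ev t x (N2 φ) = ∑ i, ∑ j, (ev t x (pd j (pd i φ))) ^ 2 := by
  simp only [N2, map_sum, ev_N1]

lemma ev_N3 (t : ℝ) (x : E3) (φ : SP) :
    ev t x (N3 φ) = ∑ i, ∑ j, ∑ l, (ev t x (pd l (pd j (pd i φ)))) ^ 2 := by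
  simp only [N3, map_sum, ev_N2]

lemma N1_nonneg (t : ℝ) (x : E3) (φ : SP) : 0 ≤ ev t x (N1 φ) := by
  rw [ev_N1]; positivity

lemma N2_nonneg (t : ℝ) (x : E3) (φ : SP) : 0 ≤ ev t x (N2 φ) := by
  rw [ev_N2]; positivity

lemma N3_nonneg (t : ℝ) (x : E3) (φ : SP) : 0 ≤ ev t x (N3 φ) := by
  rw [ev_N3]; positivity

lemma sq_le_N1 (t : ℝ) (x : E3) (φ : SP) (i : Fin 3) :
    (ev t x (pd i φ)) ^ 2 ≤ ev t x (N1 φ) := by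
  rw [ev_N1]
  exact Finset.single_le_sum (f := fun i => (ev t x (pd i φ)) ^ 2) (fun _ _ => sq_nonneg _)
    (Finset.mem_univ i)

lemma sq_le_N2 (t : ℝ) (x : E3) (φ : SP) (i j : Fin 3) :
    (ev t x (pd j (pd i φ))) ^ 2 ≤ ev t x (N2 φ) := by
  refine (sq_le_N1 t x (pd i φ) j).trans ?_
  rw [N2, map_sum]
  exact Finset.single_le_sum (f := fun i => ev t x (N1 (pd i φ))) (fun _ _ => N1_nonneg _ _ _)
    (Finset.mem_univ i)

lemma sq_le_N3 (t : ℝ) (x : E3) (φ : SP) (i j l : Fin 3) :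
    (ev t x (pd l (pd j (pd i φ)))) ^ 2 ≤ ev t x (N3 φ) := by
  refine (sq_le_N2 t x (pd i φ) j l).trans ?_
  rw [N3, map_sum]
  exact Finset.single_le_sum (f := fun i => ev t x (N2 (pd i φ))) (fun _ _ => N2_nonneg _ _ _)
    (Finset.mem_univ i)

/-- The data of the averaging problem, with `μ = m²(κ₀ + κ₁)` and all a priori bounds expressed
through one constant `L`; `θ` is the time corrector, `Dₜθ = τ⁻¹(e - 1) + S`. -/
structure Data (L : ℝ) where
  (T κ₀ κ₁ τ μ m : ℝ)
  (e θ S ρ ρb : SP)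
  (u : Fin 3 → SP)
  one_le : 1 ≤ L
  T_pos : 0 < T
  κ₀_pos : 0 < κ₀
  κ_lt : κ₀ < κ₁
  τ_pos : 0 < τ
  m_pos : 0 < m
  μ_eq : μ = m ^ 2 * (κ₀ + κ₁)
  ε_le : τ * μ ≤ 1
  div_u : ∑ j, pd j (u j) = 0
  sol : Sol u T ρ (fun j => (cst κ₀ + cst κ₁ * e) * pd j ρ) 0
  solb : Sol u T ρb (fun j => cst (κ₀ + κ₁) * pd j ρb) 0
  Dm_θ : Dm u θ = cst τ⁻¹ * (e - 1) + S
  θ_zero : ∀ x, ev 0 x θ = 0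
  init_eq : ∀ x, ev 0 x ρ = ev 0 x ρb
  e_nonneg : ∀ t ∈ Icc 0 T, ∀ x, 0 ≤ ev t x e
  e_le : ∀ t ∈ Icc 0 T, ∀ x, ev t x e ≤ L
  de_sq : ∀ t ∈ Icc 0 T, ∀ x i, (ev t x (pd i e)) ^ 2 ≤ L * m ^ 2 * ev t x e
  de_le : ∀ t ∈ Icc 0 T, ∀ x i, |ev t x (pd i e)| ≤ L * m
  dde_le : ∀ t ∈ Icc 0 T, ∀ x i j, |ev t x (pd i (pd j e))| ≤ L * m ^ 2
  θ_le : ∀ t ∈ Icc 0 T, ∀ x, |ev t x θ| ≤ 1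
  dθ_le : ∀ t ∈ Icc 0 T, ∀ x i, |ev t x (pd i θ)| ≤ L * m
  ddθ_le : ∀ t ∈ Icc 0 T, ∀ x i j, |ev t x (pd i (pd j θ))| ≤ L * m ^ 2
  S_le : ∀ t ∈ Icc 0 T, ∀ x, |ev t x S| ≤ L * μ
  du_le : ∀ t ∈ Icc 0 T, ∀ x i j, |ev t x (pd i (u j))| ≤ L * μ
  ddu_le : ∀ t ∈ Icc 0 T, ∀ x i j l, |ev t x (pd i (pd j (u l)))| ≤ L * m * μ
  init_one : Int3 0 (N1 ρb) ≤ L * m ^ 2 * ((κ₀ + κ₁) * II T (N1 ρb))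
  init_two : Int3 0 (N2 ρb) ≤ L * m ^ 4 * ((κ₀ + κ₁) * II T (N1 ρb))

namespace Data

variable {L : ℝ} (d : Data L)

/-- The averaged diffusivity. -/
def κ : ℝ := d.κ₀ + d.κ₁

/-- The total dissipation of the averaged problem. -/
def D : ℝ := d.κ * II d.T (N1 d.ρb)

lemma κ_pos : 0 < d.κ := add_pos d.κ₀_pos (d.κ₀_pos.trans d.κ_lt)

lemma κ₁_pos : 0 < d.κ₁ := d.κ₀_pos.trans d.κ_lt

lemma κ₁_le : d.κ₁ ≤ d.κ := le_add_of_nonneg_left d.κ₀_pos.le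

lemma μ_eq' : d.μ = d.m ^ 2 * d.κ := d.μ_eq

lemma μ_pos : 0 < d.μ := by
  have := d.m_pos; have := d.κ_pos; rw [d.μ_eq']; positivity

lemma L_pos (d : Data L) : 0 < L := one_pos.trans_le d.one_le

lemma D_nonneg : 0 ≤ d.D :=
  mul_nonneg d.κ_pos.le (II_nonneg d.T_pos.le fun _ _ _ => N1_nonneg _ _ _)

end Data

lemma abs_mul_mul_le {c a b M A : ℝ} (hc : |c| ≤ M) (ha : a ^ 2 ≤ A) (hb : b ^ 2 ≤ A) :
    |c * a * b| ≤ M * A := by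
  rw [mul_assoc, abs_mul]
  refine mul_le_mul hc ?_ (abs_nonneg _) ((abs_nonneg c).trans hc)
  rw [abs_le]
  constructor <;> nlinarith [sq_nonneg (a + b), sq_nonneg (a - b)]

lemma sum_abs_le {f : Fin 3 → ℝ} {B : ℝ} (h : ∀ i, |f i| ≤ B) : |∑ i, f i| ≤ 3 * B := by
  refine (Finset.abs_sum_le_sum_abs _ _).trans ?_
  refine (Finset.sum_le_sum fun i _ => h i).trans ?_
  simp

/-- Energy inequality for constant diffusivity. -/
lemma energy_le {u : Fin 3 → SP} (hu : ∑ j, pd j (u j) = 0) {T κ : ℝ} {φ g B : SP}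
    (h : Sol u T φ (fun j => cst κ * pd j φ) g)
    (hB : ∀ t ∈ Icc 0 T, ∀ x, |ev t x (φ * g)| ≤ ev t x B) {t : ℝ} (ht : t ∈ Icc 0 T) :
    Int3 t (φ * φ) + 2 * κ * II t (N1 φ) ≤ Int3 0 (φ * φ) + 2 * II T B := by
  have h1 := energy_one hu h ht
  have h2 : cst 2 * ∑ j, pd j φ * (cst κ * pd j φ) = cst 2 * (cst κ * N1 φ) := by
    simp only [N1, Finset.mul_sum]
    exact Finset.sum_congr rfl fun j _ => by ring
  have h3 : II t (φ * g) ≤ II t B := II_mono ht.1 fun s hs x =>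
    (le_abs_self _).trans (hB s ⟨hs.1, hs.2.trans ht.2⟩ x)
  have h4 : II t B ≤ II T B := II_mono_time ht fun s hs x => (abs_nonneg _).trans (hB s hs x)
  simp only [map_sub, II_cst_mul, h2] at h1
  linarith

lemma sum_N1 (φ : SP) : ∑ i, ∑ j, N1 (pd j (pd i φ)) = N3 φ := rfl

namespace Data

variable {L : ℝ} (d : Data L)

lemma solb_pd (i : Fin 3) : Sol d.u d.T (pd i d.ρb) (fun j => cst d.κ * pd j (pd i d.ρb))
    (-∑ j, pd i (d.u j) * pd j d.ρb) := by
  have h := d.solb.pd i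
  have h1 : (fun j => pd i (cst (d.κ₀ + d.κ₁) * pd j d.ρb))
      = fun j => cst d.κ * pd j (pd i d.ρb) := by
    funext j
    simp only [Derivation.leibniz, smul_eq_mul, pd_cst, mul_zero, add_zero, κ]
    rw [pd_comm i j]
  rw [h1] at h
  convert h using 1
  rw [map_zero, zero_sub]

lemma solb_pd_pd (i j : Fin 3) : Sol d.u d.T (pd j (pd i d.ρb))
    (fun l => cst d.κ * pd l (pd j (pd i d.ρb)))
    (-∑ l, (pd j (pd i (d.u l)) * pd l d.ρb + pd i (d.u l) * pd j (pd l d.ρb)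
      + pd j (d.u l) * pd l (pd i d.ρb))) := by
  have h := (d.solb_pd i).pd j
  have h1 : (fun l => pd j (cst d.κ * pd l (pd i d.ρb)))
      = fun l => cst d.κ * pd l (pd j (pd i d.ρb)) := by
    funext l
    simp only [Derivation.leibniz, smul_eq_mul, pd_cst, mul_zero, add_zero]
    rw [pd_comm j l]
  rw [h1] at h
  convert h using 1
  simp only [map_neg, Fin.sum_univ_three, map_add, Derivation.leibniz, smul_eq_mul]
  ring

lemma gradient_energy {t : ℝ} (ht : t ∈ Icc 0 d.T) :
    Int3 t (N1 d.ρb) + 2 * d.κ * II t (N2 d.ρb) ≤ 19 * L * d.m ^ 2 * d.D := by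
  have h1 : ∀ i, Int3 t (pd i d.ρb * pd i d.ρb) + 2 * d.κ * II t (N1 (pd i d.ρb))
      ≤ Int3 0 (pd i d.ρb * pd i d.ρb) + 2 * II d.T (cst (3 * L * d.μ) * N1 d.ρb) := by
    refine fun i => energy_le d.div_u (d.solb_pd i) (fun s hs x => ?_) ht
    have hb : |∑ j, ev s x (pd i (d.u j)) * ev s x (pd i d.ρb) * ev s x (pd j d.ρb)|
        ≤ 3 * (L * d.μ * ev s x (N1 d.ρb)) :=
      sum_abs_le fun j =>
        abs_mul_mul_le (d.du_le s hs x i j) (sq_le_N1 _ _ _ _) (sq_le_N1 _ _ _ _)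
    simp only [map_neg, map_sum, map_mul, ev_cst]
    rw [mul_neg, abs_neg, Finset.mul_sum]
    refine le_trans (le_of_eq ?_) (hb.trans (le_of_eq (by ring)))
    congr 1
    exact Finset.sum_congr rfl fun j _ => by ring
  generalize hb : II d.T (cst (3 * L * d.μ) * N1 d.ρb) = b at h1
  have h2 := Finset.sum_le_sum fun i (_ : i ∈ Finset.univ) => h1 i
  simp only [Finset.sum_add_distrib, ← Finset.mul_sum, ← map_sum, Finset.sum_const,
    Finset.card_univ, Fintype.card_fin, nsmul_eq_mul] at h2
  have h3 : Int3 0 (N1 d.ρb) ≤ L * d.m ^ 2 * d.D := d.init_one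
  have h5 : L * d.μ * II d.T (N1 d.ρb) = L * d.m ^ 2 * d.D := by
    rw [D, d.μ_eq']; ring
  rw [II_cst_mul] at hb
  rw [show ∑ i, pd i d.ρb * pd i d.ρb = N1 d.ρb from rfl,
    show ∑ i, N1 (pd i d.ρb) = N2 d.ρb from rfl] at h2
  push_cast at h2
  linarith

lemma hessian_energy {t : ℝ} (ht : t ∈ Icc 0 d.T) :
    Int3 t (N2 d.ρb) + 2 * d.κ * II t (N3 d.ρb) ≤ 2000 * L ^ 2 * d.m ^ 4 * d.D := by
  have hL := d.one_le
  have hm := d.m_pos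
  have hκ := d.κ_pos
  have hμ := d.μ_pos
  have h1 : ∀ i j, Int3 t (pd j (pd i d.ρb) * pd j (pd i d.ρb))
        + 2 * d.κ * II t (N1 (pd j (pd i d.ρb)))
      ≤ Int3 0 (pd j (pd i d.ρb) * pd j (pd i d.ρb))
        + 2 * II d.T (cst (9 * L * d.μ) * (cst (d.m ^ 2) * N1 d.ρb + N2 d.ρb)) := by
    refine fun i j => energy_le d.div_u (d.solb_pd_pd i j) (fun s hs x => ?_) ht
    set A : ℝ := d.m ^ 2 * ev s x (N1 d.ρb) + ev s x (N2 d.ρb) with hA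
    have a1 : ∀ l, (d.m * ev s x (pd l d.ρb)) ^ 2 ≤ A := fun l => by
      have := sq_le_N1 s x d.ρb l
      have := N2_nonneg s x d.ρb
      rw [mul_pow, hA]
      nlinarith [mul_le_mul_of_nonneg_left (sq_le_N1 s x d.ρb l) (sq_nonneg d.m)]
    have a2 : ∀ l k, (ev s x (pd k (pd l d.ρb))) ^ 2 ≤ A := fun l k => by
      have := sq_le_N2 s x d.ρb l k
      have := mul_nonneg (sq_nonneg d.m) (N1_nonneg s x d.ρb)
      rw [hA]; linarith
    have hb : |∑ l, (ev s x (pd j (pd i (d.u l))) / d.m * ev s x (pd j (pd i d.ρb))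
          * (d.m * ev s x (pd l d.ρb))
        + ev s x (pd i (d.u l)) * ev s x (pd j (pd i d.ρb)) * ev s x (pd j (pd l d.ρb))
        + ev s x (pd j (d.u l)) * ev s x (pd j (pd i d.ρb)) * ev s x (pd l (pd i d.ρb)))|
        ≤ 3 * (L * d.μ * A + L * d.μ * A + L * d.μ * A) := by
      refine sum_abs_le fun l => (abs_add_three _ _ _).trans (add_le_add (add_le_add ?_ ?_) ?_)
      · refine abs_mul_mul_le ?_ (a2 _ _) (a1 _)
        rw [abs_div, abs_of_pos hm, div_le_iff₀ hm]
        linarith [d.ddu_le s hs x j i l]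
      · exact abs_mul_mul_le (d.du_le s hs x i l) (a2 _ _) (a2 _ _)
      · exact abs_mul_mul_le (d.du_le s hs x j l) (a2 _ _) (a2 _ _)
    simp only [map_neg, map_sum, map_add, map_mul, ev_cst]
    rw [mul_neg, abs_neg, Finset.mul_sum]
    refine le_trans (le_of_eq ?_) (hb.trans (le_of_eq (by rw [hA]; ring)))
    congr 1
    refine Finset.sum_congr rfl fun l _ => ?_
    field_simp
  generalize hb : II d.T (cst (9 * L * d.μ) * (cst (d.m ^ 2) * N1 d.ρb + N2 d.ρb)) = b at h1
  have h2 := Finset.sum_le_sum fun i (_ : i ∈ Finset.univ) =>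
    Finset.sum_le_sum fun j (_ : j ∈ Finset.univ) => h1 i j
  simp only [Finset.sum_add_distrib, ← Finset.mul_sum, ← map_sum, Finset.sum_const,
    Finset.card_univ, Fintype.card_fin, nsmul_eq_mul] at h2
  have h3 : Int3 0 (N2 d.ρb) ≤ L * d.m ^ 4 * d.D := d.init_two
  have h4 := d.gradient_energy (t := d.T) ⟨d.T_pos.le, le_rfl⟩
  have h5 : 0 ≤ Int3 d.T (N1 d.ρb) := Int3_nonneg fun _ => N1_nonneg _ _ _
  have h6 : d.κ * II d.T (N2 d.ρb) ≤ 10 * L * d.m ^ 2 * d.D := by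
    have := mul_nonneg (mul_nonneg d.L_pos.le (sq_nonneg d.m)) d.D_nonneg
    linarith
  have h7 := mul_le_mul_of_nonneg_left h6 (by positivity : 0 ≤ L * d.m ^ 2)
  rw [sum_N1] at h2
  simp only [map_add, II_cst_mul] at hb
  rw [show ∑ i, ∑ j, pd j (pd i d.ρb) * pd j (pd i d.ρb) = N2 d.ρb from rfl] at h2
  have h8 : L * d.m ^ 4 * d.D ≤ L ^ 2 * d.m ^ 4 * d.D := by
    have := d.D_nonneg
    gcongr
    nlinarith
  push_cast at h2
  have h9 : L * d.μ * (d.m ^ 2 * II d.T (N1 d.ρb)) = L * d.m ^ 4 * d.D := by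
    rw [D, d.μ_eq']; ring
  have h10 : L * d.μ * II d.T (N2 d.ρb) = L * d.m ^ 2 * (d.κ * II d.T (N2 d.ρb)) := by
    rw [d.μ_eq']; ring
  have h11 : 0 ≤ L ^ 2 * d.m ^ 4 * d.D := by
    have := d.D_nonneg
    positivity
  nlinarith

end Data

lemma abs_mul_le_mul {a b A B : ℝ} (ha : |a| ≤ A) (hb : |b| ≤ B) : |a * b| ≤ A * B := by
  rw [abs_mul]
  exact mul_le_mul ha hb (abs_nonneg _) ((abs_nonneg _).trans ha)

lemma Dm_sum_pd {u : Fin 3 → SP} (hu : ∑ j, pd j (u j) = 0) (P : Fin 3 → SP) :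
    Dm u (∑ i, pd i (P i)) = ∑ j, pd j (Dm u (P j) - ∑ i, pd i (u j) * P i) := by
  have h1 : ∀ i, ∑ j, pd j (pd i (u j)) = 0 := fun i => by
    have := congrArg (pd i) hu
    rw [map_zero, map_sum] at this
    rw [← this]
    exact Finset.sum_congr rfl fun j _ => pd_comm j i _
  have h2 : Dm u (∑ i, pd i (P i)) = ∑ i, Dm u (pd i (P i)) := by
    simp only [Dm, Fin.sum_univ_three, map_add]
    ring
  have h3 : ∑ j, pd j (∑ i, pd i (u j) * P i)
      = ∑ i, ∑ j, pd i (u j) * pd j (P i) + ∑ i, P i * ∑ j, pd j (pd i (u j)) := by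
    simp only [Fin.sum_univ_three, map_add, Derivation.leibniz, smul_eq_mul]
    ring
  simp only [h1, mul_zero, Finset.sum_const_zero, add_zero] at h3
  rw [h2]
  simp only [Dm_pd, map_sub, Finset.sum_sub_distrib, h3]

namespace Data

variable {L : ℝ} (d : Data L)

/-- The size `τκ₁` of the corrector. -/
def z : ℝ := d.τ * d.κ₁

/-- The small parameter. -/
def ε : ℝ := d.τ * d.μ

/-- The oscillating diffusivity. -/
def kt : SP := cst d.κ₀ + cst d.κ₁ * d.e

/-- Weighted second order quantity. -/
def H : SP := cst (d.m ^ 2) * N1 d.ρb + N2 d.ρb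

/-- Weighted third order quantity. -/
def G : SP := cst (d.m ^ 4) * N1 d.ρb + cst (d.m ^ 2) * N2 d.ρb + N3 d.ρb

/-- The corrector. -/
def v : SP := cst d.z * ∑ i, pd i (d.θ * pd i d.ρb)

/-- The difference of the solutions. -/
def w : SP := d.ρ - d.ρb

/-- The remainder flux in the equation for `w - v`. -/
def F (j : Fin 3) : SP := d.kt * pd j d.v - cst d.z * (d.S * pd j d.ρb
  + d.θ * (cst d.κ * (∑ l, pd l (pd l (pd j d.ρb))) - ∑ i, pd j (d.u i) * pd i d.ρb)
  - ∑ i, pd i (d.u j) * (d.θ * pd i d.ρb))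

lemma z_pos : 0 < d.z := mul_pos d.τ_pos d.κ₁_pos

lemma ε_pos : 0 < d.ε := mul_pos d.τ_pos d.μ_pos

lemma z_mul_m : d.z * d.m ^ 2 ≤ d.ε := by
  rw [z, ε, d.μ_eq', mul_assoc, mul_comm (d.m ^ 2)]
  have := d.τ_pos
  have := d.κ₁_le
  gcongr

lemma z_mul_sq : d.z ^ 2 * d.m ^ 4 ≤ d.ε ^ 2 := by
  have := pow_le_pow_left₀ (by have := d.z_pos; positivity) d.z_mul_m 2
  nlinarith

lemma kt_nonneg {s : ℝ} (hs : s ∈ Icc 0 d.T) (x : E3) : 0 ≤ ev s x d.kt := by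
  have := mul_nonneg d.κ₁_pos.le (d.e_nonneg s hs x)
  simp only [kt, map_add, map_mul, ev_cst]
  linarith [d.κ₀_pos]

lemma κ₀_le_kt {s : ℝ} (hs : s ∈ Icc 0 d.T) (x : E3) : d.κ₀ ≤ ev s x d.kt := by
  have := mul_nonneg d.κ₁_pos.le (d.e_nonneg s hs x)
  simp only [kt, map_add, map_mul, ev_cst]
  linarith [d.κ₀_pos]

lemma kt_le {s : ℝ} (hs : s ∈ Icc 0 d.T) (x : E3) : ev s x d.kt ≤ L * d.κ := by
  have := mul_le_mul_of_nonneg_left (d.e_le s hs x) d.κ₁_pos.le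
  have := mul_le_mul_of_nonneg_right d.one_le d.κ₀_pos.le
  simp only [kt, map_add, map_mul, ev_cst, κ]
  linarith

lemma G_nonneg (s : ℝ) (x : E3) : 0 ≤ ev s x d.G := by
  have := N1_nonneg s x d.ρb
  have := N2_nonneg s x d.ρb
  have := N3_nonneg s x d.ρb
  have := d.m_pos
  simp only [G, map_add, map_mul, ev_cst]
  positivity

lemma abs_pd_le_G (s : ℝ) (x : E3) (i : Fin 3) :
    |ev s x (pd i d.ρb)| ≤ √(ev s x d.G) / d.m ^ 2 := by
  have hm := d.m_pos
  rw [le_div_iff₀ (by positivity), ← abs_of_pos (by positivity : 0 < d.m ^ 2), ← abs_mul]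
  refine Real.abs_le_sqrt ?_
  have := mul_le_mul_of_nonneg_left (sq_le_N1 s x d.ρb i) (by positivity : 0 ≤ d.m ^ 4)
  have := mul_nonneg (sq_nonneg d.m) (N2_nonneg s x d.ρb)
  have := N3_nonneg s x d.ρb
  simp only [G, map_add, map_mul, ev_cst]
  linarith

lemma abs_pd_pd_le_G (s : ℝ) (x : E3) (i j : Fin 3) :
    |ev s x (pd j (pd i d.ρb))| ≤ √(ev s x d.G) / d.m := by
  have hm := d.m_pos
  rw [le_div_iff₀ (by positivity)]
  nth_rw 1 [← abs_of_pos hm]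
  rw [← abs_mul]
  refine Real.abs_le_sqrt ?_
  have := mul_le_mul_of_nonneg_left (sq_le_N2 s x d.ρb i j) (by positivity : 0 ≤ d.m ^ 2)
  have := mul_nonneg (by positivity : 0 ≤ d.m ^ 4) (N1_nonneg s x d.ρb)
  have := N3_nonneg s x d.ρb
  simp only [G, map_add, map_mul, ev_cst]
  linarith

lemma abs_pd_pd_pd_le_G (s : ℝ) (x : E3) (i j l : Fin 3) :
    |ev s x (pd l (pd j (pd i d.ρb)))| ≤ √(ev s x d.G) := by
  have hm := d.m_pos
  refine Real.abs_le_sqrt ?_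
  have := sq_le_N3 s x d.ρb i j l
  have := mul_nonneg (by positivity : 0 ≤ d.m ^ 4) (N1_nonneg s x d.ρb)
  have := mul_nonneg (by positivity : 0 ≤ d.m ^ 2) (N2_nonneg s x d.ρb)
  simp only [G, map_add, map_mul, ev_cst]
  linarith

lemma abs_pd_le_H (s : ℝ) (x : E3) (i : Fin 3) :
    |ev s x (pd i d.ρb)| ≤ √(ev s x d.H) / d.m := by
  have hm := d.m_pos
  rw [le_div_iff₀ (by positivity)]
  nth_rw 1 [← abs_of_pos hm]
  rw [← abs_mul]
  refine Real.abs_le_sqrt ?_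
  have := mul_le_mul_of_nonneg_left (sq_le_N1 s x d.ρb i) (by positivity : 0 ≤ d.m ^ 2)
  have := N2_nonneg s x d.ρb
  simp only [H, map_add, map_mul, ev_cst]
  linarith

lemma abs_pd_pd_le_H (s : ℝ) (x : E3) (i j : Fin 3) :
    |ev s x (pd j (pd i d.ρb))| ≤ √(ev s x d.H) := by
  refine Real.abs_le_sqrt ?_
  have := sq_le_N2 s x d.ρb i j
  have := mul_nonneg (sq_nonneg d.m) (N1_nonneg s x d.ρb)
  simp only [H, map_add, map_mul, ev_cst]
  linarith

lemma H_nonneg (s : ℝ) (x : E3) : 0 ≤ ev s x d.H := by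
  have := N1_nonneg s x d.ρb
  have := N2_nonneg s x d.ρb
  have := d.m_pos
  simp only [H, map_add, map_mul, ev_cst]
  positivity

lemma Int3_H_le {t : ℝ} (ht : t ∈ Icc 0 d.T) :
    Int3 t d.H ≤ 2019 * L ^ 2 * d.m ^ 4 * d.D := by
  have h1 := d.gradient_energy ht
  have h2 := d.hessian_energy ht
  have h3 : 0 ≤ II t (N2 d.ρb) := II_nonneg ht.1 fun _ _ _ => N2_nonneg _ _ _
  have h4 : 0 ≤ II t (N3 d.ρb) := II_nonneg ht.1 fun _ _ _ => N3_nonneg _ _ _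
  have h5 := mul_nonneg d.κ_pos.le h3
  have h6 := mul_nonneg d.κ_pos.le h4
  have h7 := mul_le_mul_of_nonneg_left (show Int3 t (N1 d.ρb) ≤ 19 * L * d.m ^ 2 * d.D by linarith)
    (sq_nonneg d.m)
  have h8 : L * d.m ^ 4 * d.D ≤ L ^ 2 * d.m ^ 4 * d.D := by
    have := d.D_nonneg
    have := d.one_le
    gcongr
    nlinarith
  simp only [H, map_add, Int3_cst_mul]
  nlinarith

lemma II_G_le : d.κ * II d.T d.G ≤ 1011 * L ^ 2 * d.m ^ 4 * d.D := by
  have hT : d.T ∈ Icc 0 d.T := ⟨d.T_pos.le, le_rfl⟩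
  have h1 := d.gradient_energy hT
  have h2 := d.hessian_energy hT
  have h3 : 0 ≤ Int3 d.T (N1 d.ρb) := Int3_nonneg fun _ => N1_nonneg _ _ _
  have h4 : 0 ≤ Int3 d.T (N2 d.ρb) := Int3_nonneg fun _ => N2_nonneg _ _ _
  have h7 := mul_le_mul_of_nonneg_left
    (show 2 * (d.κ * II d.T (N2 d.ρb)) ≤ 19 * L * d.m ^ 2 * d.D by linarith) (sq_nonneg d.m)
  have hD := d.D_nonneg
  have hL := d.one_le
  have h8 : L * d.m ^ 4 * d.D ≤ L ^ 2 * d.m ^ 4 * d.D := by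
    gcongr
    nlinarith
  have h9 : 1 * d.m ^ 4 * d.D ≤ L ^ 2 * d.m ^ 4 * d.D := by
    gcongr
    nlinarith
  have h10 : d.m ^ 4 * (d.κ * II d.T (N1 d.ρb)) = d.m ^ 4 * d.D := rfl
  have h11 : 0 ≤ L ^ 2 * d.m ^ 4 * d.D := by positivity
  simp only [G, map_add, II_cst_mul]
  linarith

lemma v_sq_le {s : ℝ} (hs : s ∈ Icc 0 d.T) (x : E3) :
    (ev s x d.v) ^ 2 ≤ 36 * L ^ 2 * d.z ^ 2 * ev s x d.H := by
  have hz := d.z_pos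
  have hm := d.m_pos
  have hL := d.one_le
  have hg := Real.sqrt_nonneg (ev s x d.H)
  have h1 : ev s x d.v = d.z * ∑ i, (ev s x (pd i d.θ) * ev s x (pd i d.ρb)
      + ev s x d.θ * ev s x (pd i (pd i d.ρb))) := by
    simp only [v, Derivation.leibniz, smul_eq_mul, map_sum, map_add, map_mul, ev_cst]
    congr 1
    exact Finset.sum_congr rfl fun i _ => by ring
  have h2 : |ev s x d.v| ≤ d.z * (3 * (2 * L * √(ev s x d.H))) := by
    rw [h1]
    refine abs_mul_le_mul (abs_of_pos hz).le (sum_abs_le fun i => (abs_add_le _ _).trans ?_)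
    refine (add_le_add (abs_mul_le_mul (d.dθ_le s hs x i) (d.abs_pd_le_H s x i))
      (abs_mul_le_mul (d.θ_le s hs x) (d.abs_pd_pd_le_H s x i i))).trans ?_
    rw [show L * d.m * (√(ev s x d.H) / d.m) = L * √(ev s x d.H) by field_simp]
    nlinarith
  rw [← sq_abs]
  refine (pow_le_pow_left₀ (abs_nonneg _) h2 2).trans (le_of_eq ?_)
  rw [mul_pow, mul_pow, mul_pow, Real.sq_sqrt (d.H_nonneg s x)]
  ring

lemma abs_pd_v_le {s : ℝ} (hs : s ∈ Icc 0 d.T) (x : E3) (j : Fin 3) :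
    |ev s x (pd j d.v)| ≤ 12 * L * d.z * √(ev s x d.G) := by
  have hz := d.z_pos
  have hm := d.m_pos
  have hL := d.one_le
  set g := √(ev s x d.G) with hg
  have hg0 : 0 ≤ g := Real.sqrt_nonneg (ev s x d.G)
  have h1 : ev s x (pd j d.v) = d.z * ∑ i, (ev s x (pd j (pd i d.θ)) * ev s x (pd i d.ρb)
      + ev s x (pd i d.θ) * ev s x (pd j (pd i d.ρb))
      + (ev s x (pd j d.θ) * ev s x (pd i (pd i d.ρb))
      + ev s x d.θ * ev s x (pd j (pd i (pd i d.ρb))))) := by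
    simp only [v, Derivation.leibniz, smul_eq_mul, map_sum, map_add, map_mul, ev_cst, pd_cst,
      mul_zero, add_zero]
    congr 1
    exact Finset.sum_congr rfl fun i _ => by ring
  rw [h1]
  refine (abs_mul_le_mul (abs_of_pos hz).le (sum_abs_le (B := 4 * L * g) fun i =>
    (abs_add_le _ _).trans ?_)).trans (le_of_eq (by ring))
  refine (add_le_add ((abs_add_le _ _).trans (add_le_add
    (abs_mul_le_mul (d.ddθ_le s hs x j i) (d.abs_pd_le_G s x i))
    (abs_mul_le_mul (d.dθ_le s hs x i) (d.abs_pd_pd_le_G s x i j))))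
    ((abs_add_le _ _).trans (add_le_add
    (abs_mul_le_mul (d.dθ_le s hs x j) (d.abs_pd_pd_le_G s x i i))
    (abs_mul_le_mul (d.θ_le s hs x) (d.abs_pd_pd_pd_le_G s x i i j))))).trans ?_
  rw [← hg, show L * d.m * (g / d.m) = L * g by field_simp,
    show L * d.m ^ 2 * (g / d.m ^ 2) = L * g by field_simp]
  nlinarith

lemma abs_F_le {s : ℝ} (hs : s ∈ Icc 0 d.T) (x : E3) (j : Fin 3) :
    |ev s x (d.F j)| ≤ 22 * L ^ 2 * d.z * d.κ * √(ev s x d.G) := by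
  have hz := d.z_pos
  have hm := d.m_pos
  have hL := d.one_le
  have hκ := d.κ_pos
  have hv := d.abs_pd_v_le hs x j
  set g := √(ev s x d.G) with hg
  have hg0 : 0 ≤ g := Real.sqrt_nonneg (ev s x d.G)
  have hu : ∀ i k l, |ev s x (pd i (d.u k)) * ev s x (pd l d.ρb)| ≤ L * d.κ * g := fun i k l =>
    (abs_mul_le_mul (d.du_le s hs x i k) (d.abs_pd_le_G s x l)).trans
      (le_of_eq (by rw [d.μ_eq', ← hg]; field_simp))
  have h1 : ev s x (d.F j) = ev s x d.kt * ev s x (pd j d.v)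
      + (-d.z) * (ev s x d.S * ev s x (pd j d.ρb)
        + ev s x d.θ * (d.κ * (∑ l, ev s x (pd l (pd l (pd j d.ρb))))
          + -∑ i, ev s x (pd j (d.u i)) * ev s x (pd i d.ρb))
        + -(ev s x d.θ * ∑ i, ev s x (pd i (d.u j)) * ev s x (pd i d.ρb))) := by
    simp only [F, map_sub, map_add, map_mul, ev_cst, Fin.sum_univ_three]
    ring
  have hk : |ev s x d.kt| ≤ L * d.κ := by
    rw [abs_of_nonneg (d.kt_nonneg hs x)]
    exact d.kt_le hs x
  have h2 : |ev s x d.S * ev s x (pd j d.ρb)| ≤ L * d.κ * g :=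
    (abs_mul_le_mul (d.S_le s hs x) (d.abs_pd_le_G s x j)).trans
      (le_of_eq (by rw [d.μ_eq', ← hg]; field_simp))
  have h3 := abs_mul_le_mul (abs_of_pos hκ).le
    (sum_abs_le fun l => d.abs_pd_pd_pd_le_G s x j l l)
  have h4 := sum_abs_le fun i => hu j i i
  have h5 := sum_abs_le fun i => hu i j i
  rw [h1]
  refine (abs_add_le _ _).trans ((add_le_add (abs_mul_le_mul hk hv)
    (abs_mul_le_mul (abs_neg d.z ▸ (abs_of_pos hz).le) (abs_add_three _ _ _ |>.trans
      (add_le_add (add_le_add h2 (abs_mul_le_mul (d.θ_le s hs x) ((abs_add_le _ _).trans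
        (add_le_add h3 ((abs_neg _).le.trans h4)))))
        ((abs_neg _).le.trans (abs_mul_le_mul (d.θ_le s hs x) h5)))))).trans ?_)
  have h6 : d.z * d.κ * g * 1 ≤ d.z * d.κ * g * L ^ 2 := by gcongr; nlinarith
  have h7 : d.z * d.κ * g * L ≤ d.z * d.κ * g * L ^ 2 := by gcongr; nlinarith
  rw [← hg]
  linarith

lemma Int3_v_le {t : ℝ} (ht : t ∈ Icc 0 d.T) :
    Int3 t (d.v * d.v) ≤ 100000 * L ^ 4 * d.ε ^ 2 * d.D := by
  have h1 : Int3 t (d.v * d.v) ≤ Int3 t (cst (36 * L ^ 2 * d.z ^ 2) * d.H) :=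
    Int3_mono fun x => by
      simp only [map_mul, ev_cst]
      simpa [sq] using d.v_sq_le ht x
  rw [Int3_cst_mul] at h1
  have h2 := mul_le_mul_of_nonneg_left (d.Int3_H_le ht) (by positivity : 0 ≤ 36 * L ^ 2 * d.z ^ 2)
  have hD := d.D_nonneg
  have h3 := mul_le_mul_of_nonneg_left d.z_mul_sq (by positivity : 0 ≤ L ^ 4 * d.D)
  have h4 : 0 ≤ L ^ 4 * d.D * d.ε ^ 2 := by positivity
  linarith

lemma II_N1_v_le : d.κ * II d.T (N1 d.v) ≤ 1000000 * L ^ 4 * d.ε ^ 2 * d.D := by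
  have h1 : II d.T (N1 d.v) ≤ II d.T (cst (432 * L ^ 2 * d.z ^ 2) * d.G) :=
    II_mono d.T_pos.le fun s hs x => by
      rw [ev_N1, map_mul, ev_cst]
      have : ∀ j, (ev s x (pd j d.v)) ^ 2 ≤ 144 * L ^ 2 * d.z ^ 2 * ev s x d.G := fun j => by
        rw [← sq_abs]
        refine (pow_le_pow_left₀ (abs_nonneg _) (d.abs_pd_v_le hs x j) 2).trans (le_of_eq ?_)
        rw [mul_pow, Real.sq_sqrt (d.G_nonneg s x)]
        ring
      refine (Finset.sum_le_sum fun j _ => this j).trans (le_of_eq ?_)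
      simp only [Fin.sum_univ_three]
      ring
  rw [II_cst_mul] at h1
  have h0 := mul_le_mul_of_nonneg_left h1 d.κ_pos.le
  have h2 := mul_le_mul_of_nonneg_left d.II_G_le (by positivity : 0 ≤ 432 * L ^ 2 * d.z ^ 2)
  have hD := d.D_nonneg
  have h3 := mul_le_mul_of_nonneg_left d.z_mul_sq (by positivity : 0 ≤ L ^ 4 * d.D)
  have h4 : 0 ≤ L ^ 4 * d.D * d.ε ^ 2 := by positivity
  linarith

lemma II_F_le : II d.T (∑ j, d.F j * d.F j) ≤ 2000000 * L ^ 6 * d.κ * d.ε ^ 2 * d.D := by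
  have h1 : II d.T (∑ j, d.F j * d.F j) ≤ II d.T (cst (1452 * L ^ 4 * d.z ^ 2 * d.κ ^ 2) * d.G) :=
    II_mono d.T_pos.le fun s hs x => by
      have : ∀ j, (ev s x (d.F j)) * ev s x (d.F j)
          ≤ 484 * L ^ 4 * d.z ^ 2 * d.κ ^ 2 * ev s x d.G := fun j => by
        rw [← sq, ← sq_abs]
        refine (pow_le_pow_left₀ (abs_nonneg _) (d.abs_F_le hs x j) 2).trans (le_of_eq ?_)
        rw [mul_pow, Real.sq_sqrt (d.G_nonneg s x)]
        ring
      simp only [map_sum, map_mul, ev_cst]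
      refine (Finset.sum_le_sum fun j _ => this j).trans (le_of_eq ?_)
      simp only [Fin.sum_univ_three]
      ring
  rw [II_cst_mul] at h1
  have hκ := d.κ_pos
  have h2 := mul_le_mul_of_nonneg_left d.II_G_le
    (by positivity : 0 ≤ 1452 * L ^ 4 * d.z ^ 2 * d.κ)
  have hD := d.D_nonneg
  have h3 := mul_le_mul_of_nonneg_left d.z_mul_sq (by positivity : 0 ≤ L ^ 6 * d.κ * d.D)
  have h4 : 0 ≤ L ^ 6 * d.κ * d.D * d.ε ^ 2 := by positivity
  linarith

lemma Dm_v {s : ℝ} (hs : s ∈ Icc 0 d.T) (x : E3) :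
    ev s x (Dm d.u d.v) = ev s x (∑ j, pd j (cst d.z * ((cst d.τ⁻¹ * (d.e - 1) + d.S) * pd j d.ρb
      + d.θ * (cst d.κ * (∑ l, pd l (pd l (pd j d.ρb))) - ∑ i, pd j (d.u i) * pd i d.ρb)
      - ∑ i, pd i (d.u j) * (d.θ * pd i d.ρb)))) := by
  have h1 : Dm d.u d.v = cst d.z * Dm d.u (∑ i, pd i (d.θ * pd i d.ρb)) := by
    have : Dm d.u (cst d.z) = 0 := by simp [Dm]
    rw [v, Dm_mul, this, mul_zero, add_zero]
  rw [h1, Dm_sum_pd d.div_u, Finset.mul_sum, map_sum, map_sum]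
  refine Finset.sum_congr rfl fun j _ => ?_
  rw [← sub_eq_zero, ← map_sub]
  have h2 : ∀ (c : ℝ) (f g : SP), cst c * pd j f - pd j (cst c * g) = cst c * pd j (f - g) := by
    intro c f g
    simp only [Derivation.leibniz, smul_eq_mul, pd_cst, map_sub]
    ring
  rw [h2, map_mul, ev_pd_eq_zero _ j x, mul_zero]
  intro y
  have h3 := d.solb_pd j s hs y
  rw [Dm_mul, d.Dm_θ]
  simp only [map_sub, map_add, map_mul, map_neg, Derivation.leibniz, smul_eq_mul, pd_cst,
    ev_cst, mul_zero, add_zero, Fin.sum_univ_three] at h3 ⊢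
  rw [h3]
  ring

lemma sol_corrected : Sol d.u d.T (d.w - d.v) (fun j => d.kt * pd j (d.w - d.v) + d.F j) 0 := by
  intro s hs x
  have h1 := d.sol s hs x
  have h2 := d.solb s hs x
  have h3 := d.Dm_v hs x
  have h4 : Dm d.u (d.w - d.v) = Dm d.u d.ρ - Dm d.u d.ρb - Dm d.u d.v := by
    simp only [w, Dm, map_sub, Fin.sum_univ_three]
    ring
  rw [h4, map_sub, map_sub, h1, h2, h3, add_zero, add_zero, add_zero, ← map_sub, ← map_sub,
    ← Finset.sum_sub_distrib, ← Finset.sum_sub_distrib]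
  congr 1
  refine Finset.sum_congr rfl fun j _ => ?_
  rw [← map_sub, ← map_sub]
  congr 1
  refine ext_ev fun s x => ?_
  have hτ := d.τ_pos.ne'
  simp only [F, w, kt, z, κ, map_sub, map_add, map_mul, ev_cst, map_one, map_sum]
  field_simp
  ring

end Data

lemma ev_N1_add_le (s : ℝ) (x : E3) (f g : SP) :
    ev s x (N1 (f + g)) ≤ 2 * ev s x (N1 f) + 2 * ev s x (N1 g) := by
  rw [ev_N1, ev_N1, ev_N1, Finset.mul_sum, Finset.mul_sum, ← Finset.sum_add_distrib]
  refine Finset.sum_le_sum fun i _ => ?_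
  rw [map_add, map_add]
  nlinarith [sq_nonneg (ev s x (pd i f) - ev s x (pd i g))]

namespace Data

variable {L : ℝ} (d : Data L)

/-- The gradient error. -/
def X : ℝ := d.κ * II d.T (N1 d.w)

/-- The gradient error weighted with the oscillating diffusivity. -/
def Y : ℝ := II d.T (d.kt * N1 d.w)

lemma X_nonneg : 0 ≤ d.X :=
  mul_nonneg d.κ_pos.le (II_nonneg d.T_pos.le fun _ _ _ => N1_nonneg _ _ _)

lemma ev_w_zero (x : E3) : ev 0 x d.w = 0 := by
  rw [w, map_sub, d.init_eq, sub_self]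

lemma ev_v_zero (x : E3) : ev 0 x d.v = 0 := by
  rw [v, map_mul, map_sum]
  refine mul_eq_zero_of_right _ (Finset.sum_eq_zero fun i _ => ev_pd_eq_zero (fun y => ?_) i x)
  rw [map_mul, d.θ_zero, zero_mul]

lemma corrected_energy {δ : ℝ} (h0 : 0 < δ) (h1 : δ ≤ 1) {t : ℝ} (ht : t ∈ Icc 0 d.T) :
    Int3 t ((d.w - d.v) * (d.w - d.v)) + 2 * II t (d.kt * N1 (d.w - d.v))
      ≤ 2 * δ * d.X + 4000000 * L ^ 6 / δ * d.ε ^ 2 * d.D := by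
  have hκ := d.κ_pos
  have hL := d.one_le
  have hD := d.D_nonneg
  have e1 := energy_one d.div_u d.sol_corrected ht
  have e2 : Int3 0 ((d.w - d.v) * (d.w - d.v)) = 0 := by
    refine le_antisymm ?_ (Int3_nonneg fun x => ?_)
    · refine (Int3_mono (g := 0) fun x => ?_).trans (by rw [map_zero])
      rw [map_mul, map_sub, d.ev_w_zero, d.ev_v_zero]
      simp
    · rw [map_mul]; exact mul_self_nonneg _
  set q := d.w - d.v with hq
  have e3 : cst 2 * (q * 0) - cst 2 * ∑ j, pd j q * (d.kt * pd j q + d.F j)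
      = -(cst 2 * (d.kt * N1 q)) + -(cst 2 * ∑ j, pd j q * d.F j) := by
    simp only [N1, Fin.sum_univ_three]
    ring
  rw [e2, zero_add, e3, map_add, map_neg, II_cst_mul] at e1
  set P : SP := cst (δ * d.κ) * N1 q + cst (1 / (δ * d.κ)) * ∑ j, d.F j * d.F j with hP
  have e4 : II t (-(cst 2 * ∑ j, pd j q * d.F j)) ≤ II t P := II_mono ht.1 fun s _ x => by
    rw [hP, map_neg, map_mul, map_add, map_mul, map_mul, ev_N1, map_sum, map_sum, ev_cst, ev_cst,
      ev_cst, Finset.mul_sum, Finset.mul_sum, Finset.mul_sum, ← Finset.sum_add_distrib,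
      ← Finset.sum_neg_distrib]
    refine Finset.sum_le_sum fun j _ => ?_
    rw [map_mul, map_mul]
    set a := ev s x (pd j q)
    set f := ev s x (d.F j)
    have h3 : 0 ≤ (δ * d.κ * a + f) ^ 2 / (δ * d.κ) := by positivity
    have h4 : (δ * d.κ * a + f) ^ 2 / (δ * d.κ)
        = δ * d.κ * a ^ 2 + 1 / (δ * d.κ) * (f * f) + 2 * (a * f) := by field_simp; ring
    linarith
  have e5 : II t P ≤ II d.T P := II_mono_time ht fun s _ x => by
    have := N1_nonneg s x q
    have h3 : 0 ≤ ev s x (∑ j, d.F j * d.F j) := by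
      simp only [map_sum, map_mul]
      exact Finset.sum_nonneg fun j _ => mul_self_nonneg _
    rw [hP, map_add, map_mul, map_mul, ev_cst, ev_cst]
    positivity
  have e6 : II d.T P = δ * (d.κ * II d.T (N1 q))
      + 1 / (δ * d.κ) * II d.T (∑ j, d.F j * d.F j) := by
    rw [hP, map_add, II_cst_mul, II_cst_mul]; ring
  have e7 : d.κ * II d.T (N1 q) ≤ 2 * d.X + 2 * (1000000 * L ^ 4 * d.ε ^ 2 * d.D) := by
    have h3 : II d.T (N1 q) ≤ II d.T (cst 2 * N1 d.w + cst 2 * N1 d.v) :=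
      II_mono d.T_pos.le fun s _ x => by
        have := ev_N1_add_le s x d.w (-d.v)
        have h4 : N1 (-d.v) = N1 d.v := by
          simp only [N1, map_neg]
          exact Finset.sum_congr rfl fun i _ => by ring
        rw [← sub_eq_add_neg, h4] at this
        rw [map_add, map_mul, map_mul, ev_cst]
        exact this
    rw [map_add, II_cst_mul, II_cst_mul] at h3
    have h4 := mul_le_mul_of_nonneg_left h3 hκ.le
    have h5 := d.II_N1_v_le
    rw [X]
    linarith
  have e8 : 1 / (δ * d.κ) * II d.T (∑ j, d.F j * d.F j)
      ≤ 2000000 * L ^ 6 / δ * d.ε ^ 2 * d.D := by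
    refine (mul_le_mul_of_nonneg_left d.II_F_le (by positivity)).trans (le_of_eq ?_)
    field_simp
  have e9 : L ^ 4 * (d.ε ^ 2 * d.D) * δ ≤ L ^ 6 / δ * (d.ε ^ 2 * d.D) := by
    have h3 : L ^ 4 ≤ L ^ 6 := pow_le_pow_right₀ hL (by norm_num)
    have h4 : L ^ 6 ≤ L ^ 6 / δ := le_div_self (by positivity) h0 h1
    have h5 : L ^ 4 * δ ≤ L ^ 6 / δ := by
      have : L ^ 4 * δ ≤ L ^ 4 * 1 := by gcongr
      linarith
    have := mul_le_mul_of_nonneg_right h5 (by positivity : 0 ≤ d.ε ^ 2 * d.D)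
    linarith
  have e10 := mul_le_mul_of_nonneg_left e7 h0.le
  rw [e6] at e5
  have e11 : 2000000 * L ^ 6 / δ * d.ε ^ 2 * d.D = 2000000 * (L ^ 6 / δ * (d.ε ^ 2 * d.D)) := by
    ring
  have e12 : 4000000 * L ^ 6 / δ * d.ε ^ 2 * d.D = 4000000 * (L ^ 6 / δ * (d.ε ^ 2 * d.D)) := by
    ring
  rw [e12]
  rw [e11] at e8
  linarith

lemma Y_le {δ : ℝ} (h0 : 0 < δ) (h1 : δ ≤ 1) :
    d.Y ≤ 2 * δ * d.X + 6000000 * L ^ 6 / δ * d.ε ^ 2 * d.D := by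
  have hκ := d.κ_pos
  have hL := d.one_le
  have hD := d.D_nonneg
  have e1 := d.corrected_energy h0 h1 (t := d.T) ⟨d.T_pos.le, le_rfl⟩
  have e2 : 0 ≤ Int3 d.T ((d.w - d.v) * (d.w - d.v)) := Int3_nonneg fun x => by
    rw [map_mul]; exact mul_self_nonneg _
  have e3 : d.Y ≤ II d.T (cst 2 * (d.kt * N1 (d.w - d.v)) + cst (2 * L * d.κ) * N1 d.v) :=
    II_mono d.T_pos.le fun s hs x => by
      have h2 := ev_N1_add_le s x (d.w - d.v) d.v
      rw [sub_add_cancel] at h2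
      have h3 := mul_le_mul_of_nonneg_left h2 (d.kt_nonneg hs x)
      have h4 := mul_le_mul_of_nonneg_right (d.kt_le hs x) (N1_nonneg s x d.v)
      simp only [map_add, map_mul, ev_cst]
      linarith
  rw [map_add, II_cst_mul, II_cst_mul] at e3
  have e4 := mul_le_mul_of_nonneg_left d.II_N1_v_le (by positivity : 0 ≤ 2 * L)
  have e5 : L ^ 5 * (d.ε ^ 2 * d.D) ≤ L ^ 6 / δ * (d.ε ^ 2 * d.D) := by
    have h3 : L ^ 5 ≤ L ^ 6 := pow_le_pow_right₀ hL (by norm_num)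
    have h4 : L ^ 6 ≤ L ^ 6 / δ := le_div_self (by positivity) h0 h1
    have := h3.trans h4
    gcongr
  have e6 : 4000000 * L ^ 6 / δ * d.ε ^ 2 * d.D = 4000000 * (L ^ 6 / δ * (d.ε ^ 2 * d.D)) := by
    ring
  have e7 : 6000000 * L ^ 6 / δ * d.ε ^ 2 * d.D = 6000000 * (L ^ 6 / δ * (d.ε ^ 2 * d.D)) := by
    ring
  rw [e6] at e1
  rw [e7]
  linarith

lemma Int3_w_le {t : ℝ} (ht : t ∈ Icc 0 d.T) :
    Int3 t (d.w * d.w) ≤ 4 * d.X + 9000000 * L ^ 6 * d.ε ^ 2 * d.D := by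
  have hL := d.one_le
  have hD := d.D_nonneg
  have e1 := d.corrected_energy one_pos le_rfl ht
  have e2 : 0 ≤ II t (d.kt * N1 (d.w - d.v)) := II_nonneg ht.1 fun s hs x => by
    rw [map_mul]
    exact mul_nonneg (d.kt_nonneg ⟨hs.1, hs.2.trans ht.2⟩ x) (N1_nonneg _ _ _)
  have e3 : Int3 t (d.w * d.w) ≤ Int3 t (cst 2 * ((d.w - d.v) * (d.w - d.v))
      + cst 2 * (d.v * d.v)) := Int3_mono fun x => by
    simp only [map_add, map_sub, map_mul, ev_cst]
    nlinarith [sq_nonneg (ev t x d.w - 2 * ev t x d.v)]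
  rw [map_add, Int3_cst_mul, Int3_cst_mul] at e3
  have e4 := d.Int3_v_le ht
  have e5 : L ^ 4 * (d.ε ^ 2 * d.D) ≤ L ^ 6 * (d.ε ^ 2 * d.D) := by
    have h3 : L ^ 4 ≤ L ^ 6 := pow_le_pow_right₀ hL (by norm_num)
    gcongr
  have e6 : 0 ≤ L ^ 6 * (d.ε ^ 2 * d.D) := by positivity
  rw [div_one] at e1
  linarith

end Data

/-- Absorption of the mixed terms in the weighted gradient estimate. -/
lemma weighted_flux_le {L κ m k c t W a h p : ℝ} (hL : 1 ≤ L) (hκ : 0 < κ) (hm : 0 < m)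
    (hk : 0 ≤ k) (hkL : k ≤ L * κ) (hc2 : c ^ 2 ≤ L * κ * m ^ 2 * k) (hc : |c| ≤ κ * (L * m))
    (ht : |t| ≤ L * m) (hW1 : 1 ≤ W) (hW3 : W ≤ 3) :
    -2 * ((t * a + W * h) * (k * h + c * p)) ≤ κ * m ^ 2 * L ^ 3 * (3 * a ^ 2 + 7 * p ^ 2) := by
  have h1 : -(2 * t * a * k * h) ≤ k * h ^ 2 / 2 + 2 * L ^ 3 * κ * m ^ 2 * a ^ 2 := by
    have e1 : 0 ≤ k * (h + 2 * (t * a)) ^ 2 / 2 := by positivity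
    have e2 : t ^ 2 ≤ (L * m) ^ 2 := by rw [← sq_abs]; gcongr
    have e3 : 2 * k * (t ^ 2 * a ^ 2) ≤ 2 * (L * κ) * ((L * m) ^ 2 * a ^ 2) := by gcongr
    linarith
  have h2 : -(2 * (h * c * p)) ≤ k * h ^ 2 / 2 + 2 * (L * κ * m ^ 2) * p ^ 2 := by
    refine (neg_le_abs _).trans (abs_le_of_sq_le_sq ?_ (by positivity))
    have e1 : h ^ 2 * p ^ 2 * c ^ 2 ≤ h ^ 2 * p ^ 2 * (L * κ * m ^ 2 * k) := by gcongr
    nlinarith [sq_nonneg (k * h ^ 2 / 2 - 2 * (L * κ * m ^ 2) * p ^ 2)]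
  have h3 : -(2 * (t * a * c * p)) ≤ L ^ 2 * κ * m ^ 2 * (a ^ 2 + p ^ 2) := by
    have e1 : |t * c * (a * p)| ≤ L * m * (κ * (L * m)) * ((a ^ 2 + p ^ 2) / 2) :=
      abs_mul_le_mul (abs_mul_le_mul ht hc) (abs_le.2 ⟨by nlinarith [sq_nonneg (a + p)],
        by nlinarith [sq_nonneg (a - p)]⟩)
    have e2 := neg_le_of_abs_le e1
    linarith
  have h4 := mul_le_mul_of_nonneg_left h2 (by linarith : 0 ≤ W)
  have h5 : W * (2 * (L * κ * m ^ 2) * p ^ 2) ≤ 3 * (2 * (L * κ * m ^ 2) * p ^ 2) := by gcongr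
  have h6 : 1 * (k * h ^ 2) ≤ W * (k * h ^ 2) := by gcongr
  have h7 : 0 ≤ k * h ^ 2 := by positivity
  have hq : 0 ≤ κ * m ^ 2 := by positivity
  have e1 : κ * m ^ 2 * L ^ 2 ≤ κ * m ^ 2 * L ^ 3 := by
    have := pow_le_pow_right₀ hL (by norm_num : 2 ≤ 3)
    gcongr
  have e2 : κ * m ^ 2 * L ≤ κ * m ^ 2 * L ^ 3 := by
    gcongr
    exact le_self_pow₀ hL (by norm_num)
  have e3 := mul_le_mul_of_nonneg_right e1 (sq_nonneg a)
  have e4 := mul_le_mul_of_nonneg_right e1 (sq_nonneg p)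
  have e5 := mul_le_mul_of_nonneg_right e2 (sq_nonneg p)
  linarith

namespace Data

variable {L : ℝ} (d : Data L)

/-- The source in the equation for the difference. -/
def h : SP := cst d.κ₁ * ∑ j, pd j ((d.e - 1) * pd j d.ρb)

lemma sol_w : Sol d.u d.T d.w (fun j => d.kt * pd j d.w) d.h := by
  intro s hs x
  have h1 := d.sol s hs x
  have h2 := d.solb s hs x
  have h4 : Dm d.u d.w = Dm d.u d.ρ - Dm d.u d.ρb := by
    simp only [w, Dm, map_sub, Fin.sum_univ_three]
    ring
  rw [h4, map_sub, h1, h2, ← map_sub]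
  congr 1
  have h5 : cst (d.κ₀ + d.κ₁) = cst d.κ₀ + cst d.κ₁ := map_add _ _ _
  simp only [w, kt, h, h5, map_sub, map_add, Derivation.leibniz, smul_eq_mul, pd_cst,
    Fin.sum_univ_three, Derivation.map_one_eq_zero]
  ring

lemma abs_pd_h_le {s : ℝ} (hs : s ∈ Icc 0 d.T) (x : E3) (i : Fin 3) :
    |ev s x (pd i d.h)| ≤ 12 * L * d.κ * √(ev s x d.G) := by
  have hm := d.m_pos
  have hL := d.one_le
  have hκ := d.κ_pos
  set g := √(ev s x d.G) with hg
  have hg0 : 0 ≤ g := Real.sqrt_nonneg (ev s x d.G)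
  have h1 : ev s x (pd i d.h) = d.κ₁ * ∑ j, (ev s x (pd i (pd j d.e)) * ev s x (pd j d.ρb)
      + ev s x (pd j d.e) * ev s x (pd i (pd j d.ρb))
      + (ev s x (pd i d.e) * ev s x (pd j (pd j d.ρb))
      + (ev s x d.e - 1) * ev s x (pd i (pd j (pd j d.ρb))))) := by
    simp only [h, Derivation.leibniz, smul_eq_mul, map_sum, map_add, map_sub, map_mul, ev_cst,
      pd_cst, mul_zero, add_zero, Derivation.map_one_eq_zero, sub_zero, map_one]
    congr 1
    exact Finset.sum_congr rfl fun i _ => by ring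
  have h2 : |ev s x d.e - 1| ≤ L := by
    rw [abs_le]
    constructor <;> linarith [d.e_nonneg s hs x, d.e_le s hs x]
  have h3 : |d.κ₁| ≤ d.κ := (abs_of_pos d.κ₁_pos).le.trans d.κ₁_le
  rw [h1]
  refine (abs_mul_le_mul h3 (sum_abs_le (B := 4 * L * g) fun j =>
    (abs_add_le _ _).trans ?_)).trans (le_of_eq (by ring))
  refine (add_le_add ((abs_add_le _ _).trans (add_le_add
    (abs_mul_le_mul (d.dde_le s hs x i j) (d.abs_pd_le_G s x j))
    (abs_mul_le_mul (d.de_le s hs x j) (d.abs_pd_pd_le_G s x j i))))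
    ((abs_add_le _ _).trans (add_le_add
    (abs_mul_le_mul (d.de_le s hs x i) (d.abs_pd_pd_le_G s x j j))
    (abs_mul_le_mul h2 (d.abs_pd_pd_pd_le_G s x j j i))))).trans (le_of_eq ?_)
  rw [← hg]
  field_simp
  ring

lemma weighted_gradient_identity :
    0 ≤ ∑ i, II d.T (Dm d.u (d.θ + cst 2) * (pd i d.w * pd i d.w)
      - cst 2 * ∑ j, pd j ((d.θ + cst 2) * pd i d.w) * pd i (d.kt * pd j d.w)
      + cst 2 * ((d.θ + cst 2) * pd i d.w * (pd i d.h - ∑ j, pd i (d.u j) * pd j d.w))) := by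
  refine Finset.sum_nonneg fun i _ => ?_
  have hT : d.T ∈ Icc 0 d.T := ⟨d.T_pos.le, le_rfl⟩
  have h1 := energy d.div_u (d.sol_w.pd i) (d.θ + cst 2) hT
  have h2 : Int3 0 ((d.θ + cst 2) * (pd i d.w * pd i d.w)) ≤ 0 := by
    refine (Int3_mono (g := 0) fun x => ?_).trans (by rw [map_zero])
    rw [map_mul, map_mul, ev_pd_eq_zero d.ev_w_zero]
    simp
  have h3 : 0 ≤ Int3 d.T ((d.θ + cst 2) * (pd i d.w * pd i d.w)) := Int3_nonneg fun x => by
    have := (abs_le.1 (d.θ_le d.T hT x)).1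
    rw [map_mul, map_add, ev_cst, map_mul]
    exact mul_nonneg (by linarith) (mul_self_nonneg _)
  linarith

lemma X_sub_Y : d.X - d.Y = II d.T (cst d.κ₁ * (1 - d.e) * N1 d.w) := by
  rw [X, Y, ← II_cst_mul, ← map_sub]
  congr 1
  refine ext_ev fun s x => ?_
  simp only [kt, κ, map_sub, map_add, map_mul, ev_cst, map_one]
  ring

lemma weighted_pointwise {s : ℝ} (hs : s ∈ Icc 0 d.T) (x : E3) :
    ev s x (cst d.κ₁ * (1 - d.e) * N1 d.w
      + cst d.z * ∑ i, (Dm d.u (d.θ + cst 2) * (pd i d.w * pd i d.w)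
      - cst 2 * ∑ j, pd j ((d.θ + cst 2) * pd i d.w) * pd i (d.kt * pd j d.w)
      + cst 2 * ((d.θ + cst 2) * pd i d.w * (pd i d.h - ∑ j, pd i (d.u j) * pd j d.w))))
    ≤ ev s x (cst ((85 * L ^ 3 * d.ε + 1 / 4) * d.κ) * N1 d.w
      + cst (15552 * L ^ 2 * d.z ^ 2 * d.κ) * d.G) := by
  have hm := d.m_pos
  have hL := d.one_le
  have hκ := d.κ_pos
  have hz := d.z_pos
  have hτ := d.τ_pos
  have hε := d.ε_pos
  set g := √(ev s x d.G) with hg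
  have hg2 : g ^ 2 = ev s x d.G := Real.sq_sqrt (d.G_nonneg s x)
  have hg0 : 0 ≤ g := Real.sqrt_nonneg (ev s x d.G)
  obtain ⟨hθ1, hθ2⟩ := abs_le.1 (d.θ_le s hs x)
  set W := ev s x d.θ + 2 with hW
  have hW0 : |W| ≤ 3 := abs_le.2 ⟨by linarith, by linarith⟩
  set k := ev s x d.kt with hk
  let a : Fin 3 → ℝ := fun i => ev s x (pd i d.w)
  set B := d.ε * d.κ with hB
  have hB0 : 0 ≤ B := by positivity
  have hzB : d.z * (d.κ * d.m ^ 2) ≤ B := by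
    have := mul_le_mul_of_nonneg_right d.z_mul_m hκ.le
    linarith
  have hzμ : d.z * d.μ ≤ B := by rw [d.μ_eq', mul_comm (d.m ^ 2)]; exact hzB
  have key : ev s x (cst d.κ₁ * (1 - d.e) * N1 d.w
      + cst d.z * ∑ i, (Dm d.u (d.θ + cst 2) * (pd i d.w * pd i d.w)
      - cst 2 * ∑ j, pd j ((d.θ + cst 2) * pd i d.w) * pd i (d.kt * pd j d.w)
      + cst 2 * ((d.θ + cst 2) * pd i d.w * (pd i d.h - ∑ j, pd i (d.u j) * pd j d.w))))
      = ∑ i, (d.z * (ev s x d.S * a i ^ 2) + d.z * (2 * (W * (a i * ev s x (pd i d.h))))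
        + ∑ j, (d.z * (-2 * ((ev s x (pd j d.θ) * a i + W * ev s x (pd j (pd i d.w)))
          * (k * ev s x (pd j (pd i d.w)) + d.κ₁ * ev s x (pd i d.e) * a j)))
          + -(d.z * (2 * (W * (ev s x (pd i (d.u j)) * (a i * a j))))))) := by
    have h0 : Dm d.u (d.θ + cst 2) = cst d.τ⁻¹ * (d.e - 1) + d.S := by
      rw [← d.Dm_θ]; simp [Dm]
    rw [h0]
    simp only [N1, kt, map_add, map_sub, map_mul, Fin.sum_univ_three, Derivation.leibniz,
      smul_eq_mul, pd_cst, ev_cst, map_one, map_zero, mul_zero, add_zero, hW, hk, a, z]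
    simp only [pd_comm (1 : Fin 3) 0, pd_comm (2 : Fin 3) 0, pd_comm (2 : Fin 3) 1]
    field_simp
    ring
  have rhs : ev s x (cst ((85 * L ^ 3 * d.ε + 1 / 4) * d.κ) * N1 d.w
      + cst (15552 * L ^ 2 * d.z ^ 2 * d.κ) * d.G)
      = ∑ i, (L ^ 3 * B * a i ^ 2 + (d.κ / 4 * a i ^ 2 + 5184 * L ^ 2 * d.z ^ 2 * d.κ * g ^ 2)
        + ∑ j, (L ^ 3 * B * (7 * a i ^ 2 + 7 * a j ^ 2)
          + L ^ 3 * B * (7 * a i ^ 2 + 7 * a j ^ 2))) := by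
    rw [hg2]
    simp only [map_add, map_mul, ev_N1, Fin.sum_univ_three, ev_cst, a, hB]
    ring
  have hLL : L ≤ L ^ 3 := le_self_pow₀ hL (by norm_num)
  rw [key, rhs]
  refine Finset.sum_le_sum fun i _ => add_le_add (add_le_add ?_ ?_)
    (Finset.sum_le_sum fun j _ => add_le_add ?_ ?_)
  · have h1 : d.z * ev s x d.S ≤ L ^ 3 * B := by
      have e1 := mul_le_mul_of_nonneg_left ((le_abs_self _).trans (d.S_le s hs x)) hz.le
      have e2 := mul_le_mul_of_nonneg_left hzμ d.L_pos.le
      have e3 := mul_le_mul_of_nonneg_right hLL hB0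
      linarith
    have := mul_le_mul_of_nonneg_right h1 (sq_nonneg (a i))
    linarith
  · have e1 : |W * (a i * ev s x (pd i d.h))| ≤ 3 * (|a i| * (12 * L * d.κ * g)) :=
      abs_mul_le_mul hW0 (abs_mul_le_mul le_rfl (d.abs_pd_h_le hs x i))
    have e2 := mul_le_mul_of_nonneg_left ((le_abs_self _).trans e1) hz.le
    have e3 : 0 ≤ d.κ * (|a i| / 2 - 72 * L * d.z * g) ^ 2 := by positivity
    have e4 := sq_abs (a i)
    have e5 : d.κ * |a i| ^ 2 = d.κ * a i ^ 2 := by rw [e4]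
    linarith
  · have hc2 : (d.κ₁ * ev s x (pd i d.e)) ^ 2 ≤ L * d.κ * d.m ^ 2 * k := by
      have e1 : d.κ₁ * ev s x d.e ≤ k := by
        simp only [hk, kt, map_add, map_mul, ev_cst]
        linarith [d.κ₀_pos]
      have e0 := mul_nonneg d.κ₁_pos.le (d.e_nonneg s hs x)
      have e2 := mul_le_mul_of_nonneg_left (d.de_sq s hs x i) (sq_nonneg d.κ₁)
      have e3 : d.κ₁ * (d.κ₁ * ev s x d.e) ≤ d.κ * k := mul_le_mul d.κ₁_le e1 e0 hκ.le
      have e4 := mul_le_mul_of_nonneg_left e3 (by positivity : 0 ≤ L * d.m ^ 2)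
      rw [mul_pow]
      linarith
    have hc : |d.κ₁ * ev s x (pd i d.e)| ≤ d.κ * (L * d.m) :=
      abs_mul_le_mul ((abs_of_pos d.κ₁_pos).le.trans d.κ₁_le) (d.de_le s hs x i)
    have e1 := weighted_flux_le (a := a i) (h := ev s x (pd j (pd i d.w))) (p := a j) hL hκ hm
      (d.kt_nonneg hs x) (d.kt_le hs x) hc2 hc (d.dθ_le s hs x j)
      (by linarith : 1 ≤ W) (by linarith)
    refine (mul_le_mul_of_nonneg_left e1 hz.le).trans ?_
    have e2 : d.z * (d.κ * d.m ^ 2) * (L ^ 3 * (3 * a i ^ 2 + 7 * a j ^ 2))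
        ≤ B * (L ^ 3 * (3 * a i ^ 2 + 7 * a j ^ 2)) := by gcongr
    have e3 : 0 ≤ L ^ 3 * B * a i ^ 2 := by positivity
    linarith
  · have e1 : |W * (ev s x (pd i (d.u j)) * (a i * a j))|
        ≤ 3 * (L * d.μ * ((a i ^ 2 + a j ^ 2) / 2)) :=
      abs_mul_le_mul hW0 (abs_mul_le_mul (d.du_le s hs x i j)
        (abs_le.2 ⟨by nlinarith [sq_nonneg (a i + a j)], by nlinarith [sq_nonneg (a i - a j)]⟩))
    have e2 := mul_le_mul_of_nonneg_left (neg_le_of_abs_le e1) hz.le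
    have e3 : d.z * d.μ * (3 * L * (a i ^ 2 + a j ^ 2)) ≤ B * (3 * L ^ 3 * (a i ^ 2 + a j ^ 2)) := by
      gcongr
    have e4 : 0 ≤ L ^ 3 * B * (a i ^ 2 + a j ^ 2) := by positivity
    linarith

lemma X_le_Y : d.X ≤ d.Y + (85 * L ^ 3 * d.ε + 1 / 4) * d.X + 20000000 * L ^ 4 * d.ε ^ 2 * d.D := by
  have h1 := II_mono d.T_pos.le fun s hs x => d.weighted_pointwise (s := s) hs x
  have h2 := mul_nonneg d.z_pos.le d.weighted_gradient_identity
  rw [map_add, II_cst_mul, ← X_sub_Y, map_sum, map_add, II_cst_mul, II_cst_mul] at h1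
  have h3 := mul_le_mul_of_nonneg_left d.II_G_le (by positivity : 0 ≤ 15552 * L ^ 2 * d.z ^ 2)
  have hD := d.D_nonneg
  have hL := d.one_le
  have h4 := mul_le_mul_of_nonneg_left d.z_mul_sq (by positivity : 0 ≤ L ^ 4 * d.D)
  have h5 : 0 ≤ L ^ 4 * d.D * d.ε ^ 2 := by positivity
  have h6 : (85 * L ^ 3 * d.ε + 1 / 4) * d.X
      = (85 * L ^ 3 * d.ε + 1 / 4) * d.κ * II d.T (N1 d.w) := by rw [X]; ring
  linarith

lemma X_le {c : ℝ} (hc0 : 0 < c) (hc1 : c ≤ 1)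
    (hc : 1 / (340 * L ^ 3) < d.ε → c * d.κ ≤ d.κ₀) :
    d.X ≤ 300000000 * L ^ 6 / c ^ 2 * d.ε ^ 2 * d.D := by
  have hX := d.X_nonneg
  have hD := d.D_nonneg
  have hL := d.one_le
  have hE : 0 ≤ L ^ 6 * (d.ε ^ 2 * d.D) := by positivity
  have hc2 : L ^ 6 * (d.ε ^ 2 * d.D) ≤ L ^ 6 * (d.ε ^ 2 * d.D) / c ^ 2 :=
    le_div_self hE (by positivity) (pow_le_one₀ hc0.le hc1)
  have h0 : 300000000 * L ^ 6 / c ^ 2 * d.ε ^ 2 * d.D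
      = 300000000 * (L ^ 6 * (d.ε ^ 2 * d.D) / c ^ 2) := by ring
  rw [h0]
  rcases le_or_gt d.ε (1 / (340 * L ^ 3)) with hε | hε
  · have h1 : 85 * L ^ 3 * d.ε ≤ 1 / 4 := by
      have := mul_le_mul_of_nonneg_left hε (by positivity : 0 ≤ 85 * L ^ 3)
      refine this.trans (le_of_eq ?_)
      field_simp
      norm_num
    have h2 := mul_le_mul_of_nonneg_right h1 hX
    have h3 := d.X_le_Y
    have h4 := d.Y_le (δ := 1 / 8) (by norm_num) (by norm_num)
    have h5 : L ^ 4 * (d.ε ^ 2 * d.D) ≤ L ^ 6 * (d.ε ^ 2 * d.D) := by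
      have h3 : L ^ 4 ≤ L ^ 6 := pow_le_pow_right₀ hL (by norm_num)
      gcongr
    linarith
  · have h1 : c * d.X ≤ d.Y := by
      have h2 : II d.T (cst (c * d.κ) * N1 d.w) ≤ d.Y := II_mono d.T_pos.le fun s hs x => by
        rw [map_mul, map_mul, ev_cst]
        exact mul_le_mul_of_nonneg_right ((hc hε).trans (d.κ₀_le_kt hs x)) (N1_nonneg _ _ _)
      rw [II_cst_mul] at h2
      rw [X]
      linarith
    have h4 := d.Y_le (δ := c / 4) (by positivity) (by linarith)
    have h5 : c * d.X ≤ 48000000 * (L ^ 6 * (d.ε ^ 2 * d.D) / c) := by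
      have : 6000000 * L ^ 6 / (c / 4) * d.ε ^ 2 * d.D
          = 24000000 * (L ^ 6 * (d.ε ^ 2 * d.D) / c) := by field_simp; ring
      rw [this] at h4
      linarith
    have h6 : d.X ≤ 48000000 * (L ^ 6 * (d.ε ^ 2 * d.D) / c) / c := by
      rw [le_div_iff₀ hc0]
      linarith
    have h7 : 48000000 * (L ^ 6 * (d.ε ^ 2 * d.D) / c) / c
        = 48000000 * (L ^ 6 * (d.ε ^ 2 * d.D) / c ^ 2) := by field_simp
    rw [h7] at h6
    linarith

end Data

lemma abs_II_le {t : ℝ} (ht : 0 ≤ t) {f g : SP}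
    (h : ∀ s ∈ Icc (0:ℝ) t, ∀ x, |ev s x f| ≤ ev s x g) : |II t f| ≤ II t g := by
  refine abs_le.2 ⟨?_, II_mono ht fun s hs x => (le_abs_self _).trans (h s hs x)⟩
  rw [← map_neg]
  refine II_mono ht fun s hs x => ?_
  rw [map_neg]
  exact (abs_le.1 (h s hs x)).1

namespace Data

variable {L : ℝ} (d : Data L)

/-- The total dissipation of the oscillating problem. -/
def Dt : ℝ := II d.T (d.kt * N1 d.ρ)

/-- The remainder in the weighted energy identity for `∇ρb` with weight `θ`. -/
def R : SP := ∑ i, (d.S * (pd i d.ρb * pd i d.ρb)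
  + ∑ j, (-cst 2 * (pd j (d.θ * pd i d.ρb) * (cst d.κ * pd j (pd i d.ρb)))
    + -cst 2 * (d.θ * pd i d.ρb * (pd i (d.u j) * pd j d.ρb))))

lemma oscillation_identity :
    d.κ₁ * II d.T ((d.e - 1) * N1 d.ρb) = d.z * (Int3 d.T (d.θ * N1 d.ρb) - II d.T d.R) := by
  have hT : d.T ∈ Icc 0 d.T := ⟨d.T_pos.le, le_rfl⟩
  have h1 : ∀ i, Int3 d.T (d.θ * (pd i d.ρb * pd i d.ρb))
      = II d.T (Dm d.u d.θ * (pd i d.ρb * pd i d.ρb)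
        - cst 2 * ∑ j, pd j (d.θ * pd i d.ρb) * (cst d.κ * pd j (pd i d.ρb))
        + cst 2 * (d.θ * pd i d.ρb * -∑ j, pd i (d.u j) * pd j d.ρb)) := fun i => by
    have h2 : Int3 0 (d.θ * (pd i d.ρb * pd i d.ρb)) = 0 := by
      refine le_antisymm ?_ ?_
      · refine (Int3_mono (g := 0) fun x => ?_).trans (by rw [map_zero])
        rw [map_mul, d.θ_zero, zero_mul, map_zero]
      · refine Int3_nonneg fun x => ?_
        rw [map_mul, d.θ_zero, zero_mul]
    have h3 := energy d.div_u (d.solb_pd i) d.θ hT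
    rwa [h2, zero_add] at h3
  have h2 := Finset.sum_congr rfl fun i (_ : i ∈ Finset.univ) => h1 i
  rw [← map_sum, ← map_sum, ← Finset.mul_sum] at h2
  rw [N1, h2, ← map_sub, ← II_cst_mul, ← II_cst_mul]
  congr 1
  rw [d.Dm_θ]
  refine ext_ev fun s x => ?_
  have hτ := d.τ_pos.ne'
  simp only [R, z, map_add, map_sub, map_mul, map_neg, Fin.sum_univ_three, Derivation.leibniz,
    smul_eq_mul, ev_cst, map_one]
  field_simp
  ring

lemma abs_R_le {s : ℝ} (hs : s ∈ Icc 0 d.T) (x : E3) :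
    |ev s x d.R| ≤ ev s x (cst (L * d.κ) * (cst (10 * d.m ^ 2) * N1 d.ρb + cst 3 * N2 d.ρb)) := by
  have hm := d.m_pos
  have hL := d.one_le
  have hκ := d.κ_pos
  have hμ := d.μ_pos
  have h1 : ev s x d.R = ∑ i, (ev s x d.S * ev s x (pd i d.ρb) ^ 2
      + ∑ j, (-2 * d.κ * (ev s x (pd j d.θ) * (ev s x (pd i d.ρb) * ev s x (pd j (pd i d.ρb))))
        + -2 * d.κ * (ev s x d.θ * ev s x (pd j (pd i d.ρb)) ^ 2)
        + -2 * (ev s x d.θ * (ev s x (pd i (d.u j))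
          * (ev s x (pd i d.ρb) * ev s x (pd j d.ρb)))))) := by
    simp only [R, map_add, map_mul, map_neg, Fin.sum_univ_three, Derivation.leibniz,
      smul_eq_mul, ev_cst]
    ring
  have h2 : ev s x (cst (L * d.κ) * (cst (10 * d.m ^ 2) * N1 d.ρb + cst 3 * N2 d.ρb))
      = ∑ i, (L * d.μ * ev s x (pd i d.ρb) ^ 2
        + ∑ j, (L * d.κ * (d.m ^ 2 * ev s x (pd i d.ρb) ^ 2 + ev s x (pd j (pd i d.ρb)) ^ 2)
          + 2 * L * d.κ * ev s x (pd j (pd i d.ρb)) ^ 2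
          + L * d.μ * (ev s x (pd i d.ρb) ^ 2 + ev s x (pd j d.ρb) ^ 2))) := by
    simp only [map_add, map_mul, ev_N1, ev_N2, Fin.sum_univ_three, ev_cst, d.μ_eq']
    ring
  rw [h1, h2]
  have h3 : ∀ a b : ℝ, |a * b| ≤ (a ^ 2 + b ^ 2) / 2 := fun a b =>
    abs_le.2 ⟨by nlinarith [sq_nonneg (a + b)], by nlinarith [sq_nonneg (a - b)]⟩
  refine (Finset.abs_sum_le_sum_abs _ _).trans (Finset.sum_le_sum fun i _ =>
    (abs_add_le _ _).trans (add_le_add ?_ ((Finset.abs_sum_le_sum_abs _ _).trans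
      (Finset.sum_le_sum fun j _ => (abs_add_three _ _ _).trans
        (add_le_add (add_le_add ?_ ?_) ?_)))))
  · exact abs_mul_le_mul (d.S_le s hs x) (abs_sq _).le
  · have e1 := abs_mul_le_mul (d.dθ_le s hs x j) (h3 (ev s x (pd i d.ρb))
      (ev s x (pd j (pd i d.ρb)) / d.m))
    have e3 := abs_mul_le_mul (abs_of_pos hm).le e1
    have e2 : |-2 * d.κ| ≤ 2 * d.κ := by
      rw [abs_mul, abs_of_pos hκ]; norm_num
    have e4 := abs_mul_le_mul e2 e3
    refine (le_of_eq ?_).trans (e4.trans (le_of_eq ?_))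
    · congr 1
      field_simp
    · field_simp
  · have e2 : |-2 * d.κ| ≤ 2 * d.κ := by
      rw [abs_mul, abs_of_pos hκ]; norm_num
    have e3 := abs_mul_le_mul e2 (abs_mul_le_mul (d.θ_le s hs x)
      (abs_sq (ev s x (pd j (pd i d.ρb)))).le)
    refine e3.trans ?_
    have : 0 ≤ d.κ * ev s x (pd j (pd i d.ρb)) ^ 2 := by positivity
    nlinarith
  · have e2 : |(-2 : ℝ)| ≤ 2 := by norm_num
    have e3 := abs_mul_le_mul e2 (abs_mul_le_mul (d.θ_le s hs x) (abs_mul_le_mul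
      (d.du_le s hs x i j) (h3 (ev s x (pd i d.ρb)) (ev s x (pd j d.ρb)))))
    exact e3.trans (le_of_eq (by ring))

lemma abs_oscillation_le : |d.κ₁ * II d.T ((d.e - 1) * N1 d.ρb)| ≤ 58 * L ^ 2 * d.ε * d.D := by
  have hT : d.T ∈ Icc 0 d.T := ⟨d.T_pos.le, le_rfl⟩
  have hκ := d.κ_pos
  have hz := d.z_pos
  have hL := d.one_le
  have hD := d.D_nonneg
  have h1 := abs_II_le d.T_pos.le fun s hs x => d.abs_R_le hs x
  rw [II_cst_mul, map_add, II_cst_mul, II_cst_mul] at h1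
  have h2 := d.gradient_energy hT
  have h3 : 0 ≤ Int3 d.T (N1 d.ρb) := Int3_nonneg fun _ => N1_nonneg _ _ _
  have h4 : 0 ≤ II d.T (N2 d.ρb) := II_nonneg hT.1 fun _ _ _ => N2_nonneg _ _ _
  have h4' := mul_nonneg hκ.le h4
  have h5 : |Int3 d.T (d.θ * N1 d.ρb)| ≤ Int3 d.T (N1 d.ρb) := by
    have e1 : ∀ x, |ev d.T x (d.θ * N1 d.ρb)| ≤ ev d.T x (N1 d.ρb) := fun x => by
      rw [map_mul]
      exact (abs_mul_le_mul (d.θ_le d.T hT x) (abs_of_nonneg (N1_nonneg _ _ _)).le).trans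
        (one_mul _).le
    refine abs_le.2 ⟨?_, Int3_mono fun x => (le_abs_self _).trans (e1 x)⟩
    rw [← map_neg]
    refine Int3_mono fun x => ?_
    rw [map_neg]
    exact (abs_le.1 (e1 x)).1
  have h6 : d.κ * II d.T (N1 d.ρb) = d.D := rfl
  have h7 : |II d.T d.R| ≤ 39 * L ^ 2 * d.m ^ 2 * d.D := by
    have e1 : L * (d.m ^ 2 * (d.κ * II d.T (N1 d.ρb))) = L * (d.m ^ 2 * d.D) := by rw [h6]
    have e2 := mul_le_mul_of_nonneg_left (show d.κ * II d.T (N2 d.ρb)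
      ≤ 19 / 2 * (L * d.m ^ 2 * d.D) by linarith) d.L_pos.le
    have e3 : L * (d.m ^ 2 * d.D) ≤ L ^ 2 * (d.m ^ 2 * d.D) := by
      have : L ≤ L ^ 2 := le_self_pow₀ hL (by norm_num)
      gcongr
    have e4 : 0 ≤ L ^ 2 * (d.m ^ 2 * d.D) := by positivity
    linarith
  have h8 : |Int3 d.T (d.θ * N1 d.ρb) - II d.T d.R| ≤ 58 * L ^ 2 * d.m ^ 2 * d.D := by
    have e3 : L * (d.m ^ 2 * d.D) ≤ L ^ 2 * (d.m ^ 2 * d.D) := by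
      have : L ≤ L ^ 2 := le_self_pow₀ hL (by norm_num)
      gcongr
    refine (abs_sub _ _).trans ?_
    linarith
  rw [oscillation_identity]
  refine (abs_mul_le_mul (abs_of_pos hz).le h8).trans ?_
  have := mul_le_mul_of_nonneg_right d.z_mul_m (by positivity : 0 ≤ 58 * L ^ 2 * d.D)
  linarith

lemma Dt_nonneg : 0 ≤ d.Dt := II_nonneg d.T_pos.le fun s hs x => by
  rw [map_mul]
  exact mul_nonneg (d.kt_nonneg hs x) (N1_nonneg _ _ _)

lemma abs_D_sub_Dt_le {M : ℝ} (hX : d.X ≤ M * d.ε ^ 2 * d.D) :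
    |d.D - d.Dt| ≤ (L + 2 * L * M + 58 * L ^ 2) * d.ε * d.D := by
  have hL := d.one_le
  have hκ := d.κ_pos
  have hε := d.ε_pos
  have hD := d.D_nonneg
  have h1 : d.D - d.Dt = -(II d.T (d.kt * (N1 d.ρ - N1 d.ρb))
      + d.κ₁ * II d.T ((d.e - 1) * N1 d.ρb)) := by
    rw [D, Dt, ← II_cst_mul, ← II_cst_mul, ← map_add, ← map_sub, ← map_neg]
    congr 1
    refine ext_ev fun s x => ?_
    simp only [kt, κ, map_sub, map_add, map_mul, map_neg, ev_cst, map_one]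
    ring
  have h2 : |II d.T (d.kt * (N1 d.ρ - N1 d.ρb))|
      ≤ II d.T (cst (L * d.κ) * (cst d.ε * N1 d.ρb + cst (1 / d.ε + 1) * N1 d.w)) :=
    abs_II_le d.T_pos.le fun s hs x => by
      rw [map_mul, map_mul, ev_cst]
      refine abs_mul_le_mul ((abs_of_nonneg (d.kt_nonneg hs x)).le.trans (d.kt_le hs x)) ?_
      rw [map_sub, ev_N1, ev_N1, map_add, map_mul, map_mul, ev_cst, ev_cst, ev_N1, ev_N1,
        ← Finset.sum_sub_distrib, Finset.mul_sum, Finset.mul_sum, ← Finset.sum_add_distrib]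
      refine (Finset.abs_sum_le_sum_abs _ _).trans (Finset.sum_le_sum fun i _ => ?_)
      rw [w, map_sub, map_sub]
      set a := ev s x (pd i d.ρ)
      set b := ev s x (pd i d.ρb)
      have e1 : 0 ≤ (d.ε * b + (a - b)) ^ 2 / d.ε := by positivity
      have e2 : 0 ≤ (d.ε * b - (a - b)) ^ 2 / d.ε := by positivity
      have e3 : (d.ε * b + (a - b)) ^ 2 / d.ε
        = d.ε * b ^ 2 + 1 / d.ε * (a - b) ^ 2 + 2 * b * (a - b) := by field_simp; ring
      have e4 : (d.ε * b - (a - b)) ^ 2 / d.ε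
        = d.ε * b ^ 2 + 1 / d.ε * (a - b) ^ 2 - 2 * b * (a - b) := by field_simp; ring
      refine abs_le.2 ⟨?_, ?_⟩ <;> nlinarith [sq_nonneg (a - b)]
  rw [II_cst_mul, map_add, II_cst_mul, II_cst_mul] at h2
  have h3 : (1 / d.ε + 1) * d.X ≤ 2 * M * d.ε * d.D := by
    have e1 : d.ε ≤ 1 := d.ε_le
    have e2 : 1 / d.ε + 1 ≤ 2 / d.ε := by
      have : 1 ≤ 1 / d.ε := by rw [le_div_iff₀ hε]; linarith
      have : 2 / d.ε = 1 / d.ε + 1 / d.ε := by ring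
      linarith
    calc (1 / d.ε + 1) * d.X ≤ 2 / d.ε * d.X := mul_le_mul_of_nonneg_right e2 d.X_nonneg
      _ ≤ 2 / d.ε * (M * d.ε ^ 2 * d.D) := by gcongr
      _ = _ := by field_simp
  have h4 := mul_le_mul_of_nonneg_left h3 d.L_pos.le
  rw [h1, abs_neg]
  refine (abs_add_le _ _).trans ((add_le_add h2 d.abs_oscillation_le).trans ?_)
  have h5 : d.κ * II d.T (N1 d.ρb) = d.D := rfl
  have h6 : d.κ * II d.T (N1 d.w) = d.X := rfl
  have h7 : L * d.κ * (d.ε * II d.T (N1 d.ρb) + (1 / d.ε + 1) * II d.T (N1 d.w))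
      = L * (d.ε * d.D) + L * ((1 / d.ε + 1) * d.X) := by
    rw [← h5, ← h6]; ring
  rw [h7]
  linarith

end Data

/-! ### Primitives in the fast variable -/

section Primitive

/-- The primitive in the last variable. -/
def prim {E : Type} (H : E × ℝ → ℝ) (q : E × ℝ) : ℝ := ∫ r in (0:ℝ)..q.2, H (q.1, r)

lemma prim_eq {E : Type} (H : E × ℝ → ℝ) (q : E × ℝ) :
    prim H q = q.2 * ∫ r in Ioc (0:ℝ) 1, H (q.1, q.2 * r) := by
  rw [← intervalIntegral.integral_of_le zero_le_one,
    intervalIntegral.mul_integral_comp_mul_left (f := fun r => H (q.1, r)), mul_zero, mul_one]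
  rfl

lemma abs_prim_le {E : Type} {H : E × ℝ → ℝ} {p : E} {s B : ℝ} (h0 : 0 ≤ s) (h1 : s ≤ 1)
    (hB : ∀ r, |H (p, r)| ≤ B) :
    |prim H (p, s)| ≤ B := by
  have h := intervalIntegral.norm_integral_le_of_norm_le_const (a := 0) (b := s)
    (f := fun r => H (p, r)) (C := B) fun r _ => hB r
  have hB0 : 0 ≤ B := (abs_nonneg _).trans (hB 0)
  rw [sub_zero, abs_of_nonneg h0] at h
  exact h.trans (mul_le_of_le_one_right hB0 h1)

lemma ae_mem_Icc_zero_one : ∀ᵐ r ∂((volume : Measure ℝ).restrict (Ioc 0 1)), r ∈ Icc (0:ℝ) 1 :=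
  (ae_restrict_mem measurableSet_Ioc).mono fun _ h => Ioc_subset_Icc_self h

variable {E : Type} [NormedAddCommGroup E] [NormedSpace ℝ E] [ProperSpace E]

lemma contDiff_prim {H : E × ℝ → ℝ} (hH : ContDiff ℝ (⊤ : ℕ∞) H) :
    ContDiff ℝ (⊤ : ℕ∞) (prim H) := by
  have h : prim H = fun q => q.2 * ∫ r in Ioc (0:ℝ) 1, H (q.1, q.2 * r) := funext (prim_eq H)
  rw [h]
  refine contDiff_snd.mul (contDiff_infty.2 fun n => ?_)
  have hG : ContDiff ℝ (⊤ : ℕ∞) fun q : (E × ℝ) × ℝ => H (q.1.1, q.1.2 * q.2) :=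
    hH.comp ((contDiff_fst.comp contDiff_fst).prodMk
      ((contDiff_snd.comp contDiff_fst).mul contDiff_snd))
  exact contDiff_integral_of_compact isCompact_Icc ae_mem_Icc_zero_one n hG

lemma contDiff_fderiv_apply {F : Type} [NormedAddCommGroup F] [NormedSpace ℝ F] {H : F → ℝ}
    (hH : ContDiff ℝ (⊤ : ℕ∞) H) (v : F) : ContDiff ℝ (⊤ : ℕ∞) fun q => fderiv ℝ H q v :=
  (hH.fderiv_right (m := (⊤ : ℕ∞)) (by simp)).clm_apply contDiff_const

lemma fderiv_prim {H : E × ℝ → ℝ} (hH : ContDiff ℝ (⊤ : ℕ∞) H) (p : E) (s : ℝ) (v : E) (w : ℝ) :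
    fderiv ℝ (prim H) (p, s) (v, w)
      = prim (fun q => fderiv ℝ H q (v, 0)) (p, s) + w * H (p, s) := by
  have h1 : ContDiff ℝ 1 H := hH.of_le (by exact_mod_cast le_top)
  have hP : HasFDerivAt (prim H) (fderiv ℝ (prim H) (p, s)) (p, s) :=
    ((contDiff_prim hH).differentiable (by simp) _).hasFDerivAt
  have hs : fderiv ℝ (prim H) (p, s) (0, 1) = H (p, s) := by
    have ha := hP.comp_hasDerivAt s ((hasDerivAt_const s p).prodMk (hasDerivAt_id s))
    have hc : Continuous fun r => H (p, r) := hH.continuous.comp (by fun_prop)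
    have hb : HasDerivAt (fun s => ∫ r in (0:ℝ)..s, H (p, r)) (H (p, s)) s :=
      intervalIntegral.integral_hasDerivAt_right (hc.intervalIntegrable _ _)
        (hc.stronglyMeasurableAtFilter _ _) hc.continuousAt
    exact ha.unique hb
  have hp : fderiv ℝ (prim H) (p, s) (v, 0) = prim (fun q => fderiv ℝ H q (v, 0)) (p, s) := by
    have ha := HasFDerivAt.comp (g := prim H) (f := fun e => (e, s)) p hP (hasFDerivAt_prodMk_left p s)
    have hG' : Continuous (fun q : E × ℝ =>
        (fderiv ℝ H (q.1, s * q.2)).comp (ContinuousLinearMap.inl ℝ E ℝ)) :=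
      ((h1.continuous_fderiv one_ne_zero).comp (by fun_prop)).clm_comp continuous_const
    have hb := (hasFDerivAt_integral_of_compact isCompact_Icc ae_mem_Icc_zero_one
      (G := fun p r => H (p, s * r))
      (G' := fun p r => (fderiv ℝ H (p, s * r)).comp (ContinuousLinearMap.inl ℝ E ℝ))
      (hH.continuous.comp (by fun_prop)) hG'
      (fun p r => hasFDerivAt_fst_slice h1 p (s * r)) p).const_mul s
    have hc : (fun p => s * ∫ r in Ioc (0:ℝ) 1, H (p, s * r)) = prim H ∘ fun p => (p, s) :=
      funext fun p => (prim_eq H (p, s)).symm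
    rw [hc] at hb
    have hd := congrArg (fun A : E →L[ℝ] ℝ => A v) (ha.unique hb)
    have he : (∫ r in Ioc (0:ℝ) 1,
        (fderiv ℝ H (p, s * r)).comp (ContinuousLinearMap.inl ℝ E ℝ)) v
        = ∫ r in Ioc (0:ℝ) 1, fderiv ℝ H (p, s * r) (v, 0) :=
      ContinuousLinearMap.integral_apply (integrable_of_continuous_of_compact isCompact_Icc
        ae_mem_Icc_zero_one (hG'.comp (by fun_prop : Continuous fun r : ℝ => (p, r)))) v
    rw [prim_eq, ← he]
    exact hd
  have h : ((v, w) : E × ℝ) = (v, 0) + w • (0, 1) := by simp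
  rw [h, map_add, map_smul, hs, hp, smul_eq_mul]

lemma prim_sub_int {H : E × ℝ → ℝ} (hper : ∀ p r, H (p, r + 1) = H (p, r))
    (hH : Continuous H) (hzero : ∀ p, ∫ r in (0:ℝ)..1, H (p, r) = 0) (p : E) (s : ℝ) (n : ℤ) :
    prim H (p, s - n) = prim H (p, s) := by
  have hf : Function.Periodic (fun r => H (p, r)) 1 := hper p
  have h := hf.intervalIntegral_add_zsmul_eq n (s - n)
  have hi : ∀ a b, IntervalIntegrable (fun r => H (p, r)) volume a b := fun a b =>
    (hH.comp (by fun_prop : Continuous fun r : ℝ => (p, r))).intervalIntegrable a b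
  have h2 : ∫ r in (s - n)..s, H (p, r) = 0 := by
    have h3 := h hi
    rw [hf.intervalIntegral_add_eq (s - n) 0, zero_add, hzero, smul_zero] at h3
    simpa using h3
  simp only [prim]
  rw [← intervalIntegral.integral_add_adjacent_intervals (hi 0 (s - n)) (hi (s - n) s), h2,
    add_zero]

end Primitive

/-! ### Pointwise inequalities -/

/-- Glaeser's inequality along a line. -/
lemma sq_deriv_le_of_nonneg {g g' g'' : ℝ → ℝ} {M : ℝ} (hg : ∀ r, 0 ≤ g r)
    (h1 : ∀ r, HasDerivAt g (g' r) r) (h2 : ∀ r, HasDerivAt g' (g'' r) r)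
    (hM : ∀ r, g'' r ≤ M) : g' 0 ^ 2 ≤ 2 * M * g 0 := by
  have key : ∀ r, g r ≤ g 0 + g' 0 * r + M / 2 * r ^ 2 := by
    have hA : ∀ r, HasDerivAt (fun r => g' r - g' 0 - M * r) (g'' r - M) r := fun r => by
      exact (((h2 r).sub_const (g' 0)).sub ((hasDerivAt_id r).const_mul M)).congr_deriv (by simp)
    have hB : ∀ r, HasDerivAt (fun r => g r - g 0 - g' 0 * r - M / 2 * r ^ 2)
        (g' r - g' 0 - M * r) r := fun r => by
      have := (((h1 r).sub_const (g 0)).sub ((hasDerivAt_id r).const_mul (g' 0))).sub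
        ((hasDerivAt_pow 2 r).const_mul (M / 2))
      refine this.congr_deriv ?_
      norm_num
      ring
    have hanti : Antitone (fun r => g' r - g' 0 - M * r) :=
      antitone_of_hasDerivAt_nonpos hA fun r => sub_nonpos.2 (hM r)
    intro r
    have hcB : Continuous fun r => g r - g 0 - g' 0 * r - M / 2 * r ^ 2 :=
      continuous_iff_continuousAt.2 fun r => (hB r).continuousAt
    rcases le_total 0 r with hr | hr
    · have := antitoneOn_of_hasDerivWithinAt_nonpos (convex_Ici 0) hcB.continuousOn
        (fun x _ => (hB x).hasDerivWithinAt) (fun x hx => by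
          rw [interior_Ici] at hx
          simpa using hanti (le_of_lt (mem_Ioi.1 hx)))
      have := this (mem_Ici.2 le_rfl) (mem_Ici.2 hr) hr
      simp only at this
      norm_num at this
      linarith
    · have := monotoneOn_of_hasDerivWithinAt_nonneg (convex_Iic 0) hcB.continuousOn
        (fun x _ => (hB x).hasDerivWithinAt) (fun x hx => by
          rw [interior_Iic] at hx
          simpa using hanti (le_of_lt (mem_Iio.1 hx)))
      have := this (mem_Iic.2 hr) (mem_Iic.2 le_rfl) hr
      simp only at this
      norm_num at this
      linarith
  have h := discrim_le_zero (a := M / 2) (b := g' 0) (c := g 0) fun r => by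
    have := key r; have := hg r; nlinarith
  rw [discrim] at h
  linarith

lemma abs_spd_le (f : E3 → ℝ) (x : E3) (i : Fin 3) : |spd i f x| ≤ ‖iteratedFDeriv ℝ 1 f x‖ := by
  rw [norm_iteratedFDeriv_one]
  simpa [spd] using (fderiv ℝ f x).le_opNorm (EuclideanSpace.single i (1:ℝ))

lemma contDiff_spd {f : E3 → ℝ} (hf : ContDiff ℝ (⊤ : ℕ∞) f) (i : Fin 3) :
    ContDiff ℝ (⊤ : ℕ∞) (spd i f) := contDiff_fderiv_apply hf _

lemma spd_spd_eq {f : E3 → ℝ} (hf : ContDiff ℝ (⊤ : ℕ∞) f) (x : E3) (i j : Fin 3) :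
    spd i (spd j f) x = fderiv ℝ (fderiv ℝ f) x (EuclideanSpace.single i (1:ℝ))
      (EuclideanSpace.single j (1:ℝ)) := by
  have hd : DifferentiableAt ℝ (fderiv ℝ f) x :=
    (hf.fderiv_right (m := (⊤ : ℕ∞)) (by simp)).differentiable (by simp) _
  have : spd j f = fun y => fderiv ℝ f y (EuclideanSpace.single j (1:ℝ)) := rfl
  rw [spd, this, fderiv_clm_apply hd (by fun_prop)]
  simp

lemma abs_spd_spd_le {f : E3 → ℝ} (hf : ContDiff ℝ (⊤ : ℕ∞) f) (x : E3) (i j : Fin 3) :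
    |spd i (spd j f) x| ≤ ‖iteratedFDeriv ℝ 2 f x‖ := by
  rw [spd_spd_eq hf]
  have h := (iteratedFDeriv ℝ 2 f x).le_opNorm
    ![EuclideanSpace.single i (1:ℝ), EuclideanSpace.single j (1:ℝ)]
  rw [iteratedFDeriv_two_apply] at h
  simpa using h

lemma sq_spd_le_of_nonneg {f : E3 → ℝ} (hf : ContDiff ℝ (⊤ : ℕ∞) f) (h0 : ∀ x, 0 ≤ f x) {M : ℝ}
    {i : Fin 3} (hM : ∀ x, spd i (spd i f) x ≤ M) (x : E3) : spd i f x ^ 2 ≤ 2 * M * f x := by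
  have hline : ∀ {g : E3 → ℝ}, ContDiff ℝ (⊤ : ℕ∞) g → ∀ r : ℝ,
      HasDerivAt (fun r : ℝ => g (x + r • EuclideanSpace.single i (1:ℝ)))
        (spd i g (x + r • EuclideanSpace.single i (1:ℝ))) r := fun {g} hg r => by
    have h1 : HasDerivAt (fun r : ℝ => x + r • (EuclideanSpace.single i (1:ℝ) : E3))
        (EuclideanSpace.single i (1:ℝ)) r := by
      simpa using ((hasDerivAt_id r).smul_const
        (EuclideanSpace.single i (1:ℝ) : E3)).const_add x
    exact (hg.differentiable (by simp) _).hasFDerivAt.comp_hasDerivAt r h1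
  simpa using sq_deriv_le_of_nonneg
    (g := fun r : ℝ => f (x + r • EuclideanSpace.single i (1:ℝ)))
    (fun r => h0 _) (hline hf) (hline (contDiff_spd hf i)) (fun r => hM _)

lemma norm_iteratedFDeriv_apply_le {v : E3 → E3} (hv : ContDiff ℝ (⊤ : ℕ∞) v) (n : ℕ) (x : E3)
    (j : Fin 3) : ‖iteratedFDeriv ℝ n (fun y => v y j) x‖ ≤ ‖iteratedFDeriv ℝ n v x‖ := by
  have h := (EuclideanSpace.proj j : E3 →L[ℝ] ℝ).norm_iteratedFDeriv_comp_left (x := x)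
    (hv.of_le (by exact_mod_cast le_top) : ContDiff ℝ n v).contDiffAt le_rfl
  have h1 : ‖(EuclideanSpace.proj j : E3 →L[ℝ] ℝ)‖ ≤ 1 :=
    ContinuousLinearMap.opNorm_le_bound _ zero_le_one fun y => by
      simpa using PiLp.norm_apply_le y j
  exact h.trans (mul_le_of_le_one_left (norm_nonneg _) h1)

/-! ### The oscillating factor and its time corrector -/

lemma unc_dir_of_prim {H : (ℝ × E3) × ℝ → ℝ} (hH : ContDiff ℝ (⊤ : ℕ∞) H) {a c : ℝ} {f : SP}
    (hf : unc f = fun p => prim H (p, a * p.1 - c)) (v : ℝ × E3) :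
    unc (dir v f) = fun p => prim (fun q => fderiv ℝ H q (v, 0)) (p, a * p.1 - c)
      + a * v.1 * H (p, a * p.1 - c) := by
  funext p
  have h1 : HasFDerivAt (prim H) (fderiv ℝ (prim H) (p, a * p.1 - c)) (p, a * p.1 - c) :=
    ((contDiff_prim hH).differentiable (by simp) _).hasFDerivAt
  have h2 : HasFDerivAt (fun p : ℝ × E3 => (p, a * p.1 - c))
      ((ContinuousLinearMap.id ℝ (ℝ × E3)).prod (a • ContinuousLinearMap.fst ℝ ℝ E3)) p :=
    (hasFDerivAt_id p).prodMk ((hasFDerivAt_fst.const_mul a).sub_const c)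
  have h3 := (HasFDerivAt.comp (g := prim H) (f := fun p : ℝ × E3 => (p, a * p.1 - c)) p h1
    h2).fderiv
  change fderiv ℝ (unc f) p v = _
  rw [hf, ← fderiv_prim hH]
  change fderiv ℝ (prim H ∘ fun p : ℝ × E3 => (p, a * p.1 - c)) p v = _
  rw [h3]
  rfl

lemma fderiv_eq_spd {H : (ℝ × E3) × ℝ → ℝ} (hH : ContDiff ℝ (⊤ : ℕ∞) H) (t : ℝ) (x : E3) (r : ℝ)
    (i : Fin 3) : fderiv ℝ H ((t, x), r) ((0, EuclideanSpace.single i (1:ℝ)), 0)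
      = spd i (fun y => H ((t, y), r)) x := by
  have h1 := (hH.differentiable (by simp) ((t, x), r)).hasFDerivAt
  have h2 : HasFDerivAt (fun y : E3 => ((t, y), r))
      (((0 : E3 →L[ℝ] ℝ).prod (ContinuousLinearMap.id ℝ E3)).prod (0 : E3 →L[ℝ] ℝ)) x :=
    ((hasFDerivAt_const t x).prodMk (hasFDerivAt_id x)).prodMk (hasFDerivAt_const r x)
  have h3 := (HasFDerivAt.comp (g := H) (f := fun y : E3 => ((t, y), r)) x h1 h2).fderiv
  change _ = fderiv ℝ (H ∘ fun y : E3 => ((t, y), r)) x _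
  rw [h3]
  rfl

lemma fderiv_eq_deriv {H : (ℝ × E3) × ℝ → ℝ} (hH : ContDiff ℝ (⊤ : ℕ∞) H) (t : ℝ) (x : E3)
    (r : ℝ) : fderiv ℝ H ((t, x), r) ((1, 0), 0) = deriv (fun t' => H ((t', x), r)) t := by
  have h1 := (hH.differentiable (by simp) ((t, x), r)).hasFDerivAt
  have h2 : HasDerivAt (fun t' : ℝ => ((t', x), r)) ((1, 0), 0) t :=
    ((hasDerivAt_id t).prodMk (hasDerivAt_const t x)).prodMk (hasDerivAt_const t r)
  exact (HasFDerivAt.comp_hasDerivAt (l := H) t h1 h2).deriv.symm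

/-- A smooth profile, periodic in space and in the fast variable, with mean one in the latter. -/
structure Profile where
  (η : ℝ → E3 → ℝ → ℝ)
  smooth : ContDiff ℝ (⊤ : ℕ∞) (fun p : ℝ × E3 × ℝ => η p.1 p.2.1 p.2.2)
  nonneg : ∀ t x s, 0 ≤ η t x s
  space : ∀ t s, SpacePeriodic (fun x => η t x s)
  fast : ∀ t x s, η t x (s + 1) = η t x s
  mean : ∀ t x, (∫ s in (0:ℝ)..1, η t x s) = 1

namespace Profile

variable (P : Profile) (a : ℝ)

/-- The mean zero part of the profile. -/
def osc (q : (ℝ × E3) × ℝ) : ℝ := P.η q.1.1 q.1.2 q.2 - 1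

lemma contDiff_osc : ContDiff ℝ (⊤ : ℕ∞) P.osc := by
  have h : ContDiff ℝ (⊤ : ℕ∞) fun q : (ℝ × E3) × ℝ => ((q.1.1, q.1.2, q.2) : ℝ × E3 × ℝ) := by
    fun_prop
  exact (P.smooth.comp h).sub contDiff_const

lemma contDiff_slice (t r : ℝ) : ContDiff ℝ (⊤ : ℕ∞) fun y => P.η t y r := by
  have h : ContDiff ℝ (⊤ : ℕ∞) fun y : E3 => ((t, y, r) : ℝ × E3 × ℝ) := by fun_prop
  exact P.smooth.comp h

lemma fast_sub_int (t : ℝ) (x : E3) (s : ℝ) (n : ℤ) : P.η t x (s - n) = P.η t x s := by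
  have hf : Function.Periodic (P.η t x) 1 := P.fast t x
  simpa using hf.sub_int_mul_eq n (x := s)

lemma prim_osc_eq (p : ℝ × E3) (s : ℝ) :
    prim P.osc (p, s) = (∫ r in (0:ℝ)..s, P.η p.1 p.2 r) - s := by
  have hc : Continuous fun r => P.η p.1 p.2 r :=
    P.smooth.continuous.comp (by fun_prop : Continuous fun r : ℝ => (p.1, p.2, r))
  simp only [prim, osc]
  rw [intervalIntegral.integral_sub (hc.intervalIntegrable _ _) (by simp)]
  simp

/-- The profile evaluated at the fast time. -/
def e : SP :=
  ⟨fun t x => P.η t x (a * t), by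
    constructor
    · have h : ContDiff ℝ (⊤ : ℕ∞) fun q : ℝ × E3 => ((q.1, q.2, a * q.1) : ℝ × E3 × ℝ) := by
        fun_prop
      exact P.smooth.comp h
    · exact fun t => P.space t (a * t)⟩

/-- The time corrector. -/
def θ : SP :=
  ⟨fun t x => prim P.osc ((t, x), a * t), by
    constructor
    · have h : ContDiff ℝ (⊤ : ℕ∞) fun q : ℝ × E3 => ((q, a * q.1) : (ℝ × E3) × ℝ) := by
        fun_prop
      exact (contDiff_prim P.contDiff_osc).comp h
    · intro t x m
      simp only [prim, osc]
      congr 1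
      funext r
      exact congrArg (· - 1) (P.space t r x m)⟩

lemma unc_θ (n : ℤ) : unc (P.θ a) = fun p => prim P.osc (p, a * p.1 - n) := by
  funext p
  refine (prim_sub_int (fun p r => ?_) P.contDiff_osc.continuous (fun p => ?_) p (a * p.1) n).symm
  · simp [osc, P.fast]
  · have := P.prim_osc_eq p 1
    rw [P.mean, sub_self] at this
    exact this

lemma unc_pd_θ (n : ℤ) (i : Fin 3) : unc (pd i (P.θ a)) = fun p =>
    prim (fun q => fderiv ℝ P.osc q ((0, EuclideanSpace.single i (1:ℝ)), 0)) (p, a * p.1 - n) := by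
  rw [pd, unc_dir_of_prim P.contDiff_osc (P.unc_θ a n)]
  simp

lemma unc_pd_pd_θ (n : ℤ) (i j : Fin 3) : unc (pd i (pd j (P.θ a))) = fun p =>
    prim (fun q => fderiv ℝ (fun q => fderiv ℝ P.osc q ((0, EuclideanSpace.single j (1:ℝ)), 0)) q
      ((0, EuclideanSpace.single i (1:ℝ)), 0)) (p, a * p.1 - n) := by
  rw [pd, unc_dir_of_prim (contDiff_fderiv_apply P.contDiff_osc _) (P.unc_pd_θ a n j)]
  simp

lemma fderiv_osc (t : ℝ) (x : E3) (r : ℝ) (i : Fin 3) :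
    fderiv ℝ P.osc ((t, x), r) ((0, EuclideanSpace.single i (1:ℝ)), 0)
      = spd i (fun y => P.η t y r) x := by
  rw [fderiv_eq_spd P.contDiff_osc]
  simp [osc, spd, fderiv_sub_const]

lemma fderiv_fderiv_osc (t : ℝ) (x : E3) (r : ℝ) (i j : Fin 3) :
    fderiv ℝ (fun q => fderiv ℝ P.osc q ((0, EuclideanSpace.single j (1:ℝ)), 0)) ((t, x), r)
      ((0, EuclideanSpace.single i (1:ℝ)), 0) = spd i (spd j (fun y => P.η t y r)) x := by
  rw [fderiv_eq_spd (contDiff_fderiv_apply P.contDiff_osc _)]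
  simp only [fderiv_osc]

lemma fract_eq (t : ℝ) : a * t - (⌊a * t⌋ : ℤ) = Int.fract (a * t) := rfl

lemma abs_prim_fract_le {H : (ℝ × E3) × ℝ → ℝ} {p : ℝ × E3} {s B : ℝ} (hB : ∀ r, |H (p, r)| ≤ B) :
    |prim H (p, s - (⌊s⌋ : ℤ))| ≤ B :=
  abs_prim_le (Int.fract_nonneg s) (Int.fract_lt_one s).le hB

lemma abs_θ_le (t : ℝ) (x : E3) : |ev t x (P.θ a)| ≤ 1 := by
  have h : ev t x (P.θ a) = prim P.osc ((t, x), a * t - (⌊a * t⌋ : ℤ)) :=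
    congrFun (P.unc_θ a ⌊a * t⌋) (t, x)
  have hc : Continuous fun r => P.η t x r :=
    P.smooth.continuous.comp (by fun_prop : Continuous fun r : ℝ => (t, x, r))
  have h0 := Int.fract_nonneg (a * t)
  have h1 := (Int.fract_lt_one (a * t)).le
  have h2 : 0 ≤ ∫ r in (0:ℝ)..Int.fract (a * t), P.η t x r :=
    intervalIntegral.integral_nonneg h0 fun r _ => P.nonneg t x r
  have h3 : ∫ r in (0:ℝ)..Int.fract (a * t), P.η t x r ≤ ∫ r in (0:ℝ)..1, P.η t x r :=
    intervalIntegral.integral_mono_interval le_rfl h0 h1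
      (Eventually.of_forall fun r => P.nonneg t x r) (hc.intervalIntegrable _ _)
  rw [P.mean] at h3
  rw [h, prim_osc_eq, fract_eq, abs_le]
  constructor <;> simp only <;> linarith

lemma abs_pd_θ_le {t : ℝ} {x : E3} {i : Fin 3} {B : ℝ}
    (hB : ∀ r, |spd i (fun y => P.η t y r) x| ≤ B) : |ev t x (pd i (P.θ a))| ≤ B := by
  rw [show ev t x (pd i (P.θ a)) = _ from congrFun (P.unc_pd_θ a ⌊a * t⌋ i) (t, x)]
  exact abs_prim_fract_le fun r => by rw [fderiv_osc]; exact hB r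

lemma abs_pd_pd_θ_le {t : ℝ} {x : E3} {i j : Fin 3} {B : ℝ}
    (hB : ∀ r, |spd i (spd j (fun y => P.η t y r)) x| ≤ B) :
    |ev t x (pd i (pd j (P.θ a)))| ≤ B := by
  rw [show ev t x (pd i (pd j (P.θ a))) = _ from congrFun (P.unc_pd_pd_θ a ⌊a * t⌋ i j) (t, x)]
  exact abs_prim_fract_le fun r => by rw [fderiv_fderiv_osc]; exact hB r

lemma abs_Dm_θ_sub_le {t : ℝ} {x : E3} {B : ℝ} (u : Fin 3 → SP)
    (hB : ∀ r, |deriv (fun t' => P.η t' x r) t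
      + ∑ i, ev t x (u i) * spd i (fun y => P.η t y r) x| ≤ B) :
    |ev t x (Dm u (P.θ a) - cst a * (P.e a - 1))| ≤ B := by
  set n : ℤ := ⌊a * t⌋ with hn
  set A : (ℝ × E3) →L[ℝ] ℝ := (fderiv ℝ (prim P.osc) ((t, x), a * t - n)).comp
    (ContinuousLinearMap.inl ℝ (ℝ × E3) ℝ) with hA
  have hAv : ∀ v, A v = prim (fun q => fderiv ℝ P.osc q (v, 0)) ((t, x), a * t - n) := fun v => by
    have := fderiv_prim P.contDiff_osc (t, x) (a * t - n) v 0
    rw [zero_mul, add_zero] at this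
    exact this
  have h1 : ev t x (td (P.θ a)) = A (1, 0) + a * (ev t x (P.e a) - 1) := by
    have := congrFun (unc_dir_of_prim P.contDiff_osc (P.unc_θ a n) (1, 0)) (t, x)
    rw [← hAv] at this
    refine this.trans ?_
    simp only [osc, fast_sub_int, mul_one]
    rfl
  have h2 : ∀ i, ev t x (pd i (P.θ a)) = A (0, EuclideanSpace.single i (1:ℝ)) := fun i => by
    rw [hAv]
    exact congrFun (P.unc_pd_θ a n i) (t, x)
  set v : ℝ × E3 := (1, 0) + ∑ i, ev t x (u i) • (0, EuclideanSpace.single i (1:ℝ)) with hv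
  have h3 : ev t x (Dm u (P.θ a) - cst a * (P.e a - 1)) = A v := by
    simp only [Dm, map_sub, map_add, map_sum, map_mul, h1, h2, ev_cst, map_one, hv, map_smul,
      smul_eq_mul]
    ring
  rw [h3, hAv]
  refine abs_prim_fract_le fun r => ?_
  have h4 : fderiv ℝ P.osc ((t, x), r) (v, 0) = deriv (fun t' => P.η t' x r) t
      + ∑ i, ev t x (u i) * spd i (fun y => P.η t y r) x := by
    set F : (ℝ × E3) →L[ℝ] ℝ := (fderiv ℝ P.osc ((t, x), r)).comp
      (ContinuousLinearMap.inl ℝ (ℝ × E3) ℝ) with hF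
    have hd : F (1, 0) = deriv (fun t' => P.η t' x r) t := by
      refine (fderiv_eq_deriv P.contDiff_osc t x r).trans ?_
      simp [osc]
    have hs : ∀ i, F (0, EuclideanSpace.single i (1:ℝ)) = spd i (fun y => P.η t y r) x :=
      fun i => P.fderiv_osc t x r i
    change F v = _
    simp only [hv, map_add, map_sum, map_smul, smul_eq_mul, hd, hs]
  rw [h4]
  exact hB r

end Profile

/-! ### Reduction to the a priori data -/

lemma spd_eq_ev (i : Fin 3) (f : SP) (t : ℝ) (x : E3) : spd i (f.1 t) x = ev t x (pd i f) := by
  rw [spd_eq]; rfl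

lemma spd_spd_eq_ev (i j : Fin 3) (f : SP) (t : ℝ) (x : E3) :
    spd i (spd j (f.1 t)) x = ev t x (pd i (pd j f)) := by
  rw [spd_eq, spd_eq]; rfl

lemma II_mul_N1_eq (T : ℝ) (g f : SP) : II T (g * N1 f)
    = ∫ t in (0:ℝ)..T, ∫ x in cube 3, g.1 t x * ∑ i, (spd i (f.1 t) x) ^ 2 := by
  simp only [spd_eq_ev, ← ev_N1]
  rfl

lemma II_N1_eq (T : ℝ) (f : SP) : II T (N1 f)
    = ∫ t in (0:ℝ)..T, ∫ x in cube 3, ∑ i, (spd i (f.1 t) x) ^ 2 := by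
  simp only [spd_eq_ev, ← ev_N1]
  rfl

lemma integrableOn_norm_iteratedFDeriv_sq {f : E3 → ℝ} (hf : ContDiff ℝ (⊤ : ℕ∞) f) (n : ℕ) :
    IntegrableOn (fun x => ‖iteratedFDeriv ℝ n f x‖ ^ 2) (cube 3) :=
  integrable_of_continuous_of_compact isCompact_ccube ae_mem_ccube
    ((hf.continuous_iteratedFDeriv (by exact_mod_cast le_top)).norm.pow 2)

lemma integral_norm_iteratedFDeriv_sq_le (f : E3 → ℝ) (n : ℕ) :
    ∫ x in cube 3, ‖iteratedFDeriv ℝ n f x‖ ^ 2 ≤ HnormSq n f :=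
  Finset.single_le_sum (f := fun m => ∫ x in cube 3, ‖iteratedFDeriv ℝ m f x‖ ^ 2)
    (fun _ _ => integral_nonneg fun _ => sq_nonneg _) (Finset.mem_range.2 n.lt_succ_self)

lemma Int3_N1_le (f : SP) (t : ℝ) : Int3 t (N1 f) ≤ 3 * HnormSq 1 (f.1 t) := by
  have h : ∀ x, ev t x (N1 f) ≤ 3 * ‖iteratedFDeriv ℝ 1 (f.1 t) x‖ ^ 2 := fun x => by
    rw [ev_N1]
    calc ∑ i, (ev t x (pd i f)) ^ 2
        ≤ ∑ _i : Fin 3, ‖iteratedFDeriv ℝ 1 (f.1 t) x‖ ^ 2 := Finset.sum_le_sum fun i _ => by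
          rw [← spd_eq_ev]
          exact sq_le_sq' (by linarith [neg_abs_le (spd i (f.1 t) x), abs_spd_le (f.1 t) x i])
            ((le_abs_self _).trans (abs_spd_le _ _ _))
      _ = _ := by simp
  refine (integral_mono (integrable_slice (N1 f) t)
    ((integrableOn_norm_iteratedFDeriv_sq (contDiff_slice f t) 1).const_mul 3) h).trans ?_
  rw [integral_const_mul]
  linarith [integral_norm_iteratedFDeriv_sq_le (f.1 t) 1]

lemma Int3_N2_le (f : SP) (t : ℝ) : Int3 t (N2 f) ≤ 9 * HnormSq 2 (f.1 t) := by
  have h : ∀ x, ev t x (N2 f) ≤ 9 * ‖iteratedFDeriv ℝ 2 (f.1 t) x‖ ^ 2 := fun x => by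
    rw [ev_N2]
    calc ∑ i, ∑ j, (ev t x (pd j (pd i f))) ^ 2
        ≤ ∑ _i : Fin 3, ∑ _j : Fin 3, ‖iteratedFDeriv ℝ 2 (f.1 t) x‖ ^ 2 :=
          Finset.sum_le_sum fun i _ => Finset.sum_le_sum fun j _ => by
            rw [← spd_spd_eq_ev]
            have := abs_spd_spd_le (contDiff_slice f t) x j i
            exact sq_le_sq' (by linarith [neg_abs_le (spd j (spd i (f.1 t)) x)])
              ((le_abs_self _).trans this)
      _ = _ := by simp; ring
  refine (integral_mono (integrable_slice (N2 f) t)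
    ((integrableOn_norm_iteratedFDeriv_sq (contDiff_slice f t) 2).const_mul 9) h).trans ?_
  rw [integral_const_mul]
  linarith [integral_norm_iteratedFDeriv_sq_le (f.1 t) 2]

lemma deriv_add_eq_ev_Dm (u : Fin 3 → SP) (f : SP) (t : ℝ) (x : E3) :
    deriv (fun s => f.1 s x) t + ∑ i, (u i).1 t x * spd i (f.1 t) x = ev t x (Dm u f) := by
  have h : deriv (fun s => f.1 s x) t = ev t x (td f) := (hasDerivAt_td f t x).deriv
  simp only [h, spd_eq_ev, Dm, map_add, map_sum, map_mul]
  rfl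

/-- A smooth periodic vector field as a family of smooth periodic functions. -/
def components (u : ℝ → E3 → E3) (hu : SmoothTS u) (hp : ∀ t, SpacePeriodic (u t))
    (i : Fin 3) : SP :=
  ⟨fun t x => u t x i,
    (EuclideanSpace.proj i : E3 →L[ℝ] ℝ).contDiff.comp hu, fun t x m => by
      simp only [hp t x m]⟩

/-- The hypotheses of the averaging theorem provide the a priori data. -/
lemma exists_data {N : ℕ} (hN : 2 ≤ N) {CN K : ℝ} (hCN : 0 < CN) (hK : 0 < K)
    {T κ₀ κ₁ τ μ : ℝ} (hT : 0 < T) (hκ₀ : 0 < κ₀) (hκ : κ₀ < κ₁) (hτ : 0 < τ) (hμ : 0 < μ)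
    (P : Profile) (hηK : ∀ t x s, P.η t x s ≤ K)
    (u : ℝ → E3 → E3) (hu : SmoothTS u) (hup : ∀ t, SpacePeriodic (u t))
    (hdiv : ∀ t x, divg (u t) x = 0)
    (hμu : ∀ t ∈ Icc (0:ℝ) T, ∀ x, ‖iteratedFDeriv ℝ 1 (u t) x‖ ≤ μ)
    (ρin : E3 → ℝ) (ρ ρb : SP) (hρ0 : ∀ x, ρ.1 0 x = ρin x) (hρb0 : ∀ x, ρb.1 0 x = ρin x)
    (hsol : ∀ t ∈ Icc (0:ℝ) T, ∀ x,
      deriv (fun s => ρ.1 s x) t + ∑ i, u t x i * spd i (ρ.1 t) x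
        = ∑ i, spd i (fun y => (κ₀ + κ₁ * P.η t y (τ⁻¹ * t)) * spd i (ρ.1 t) y) x)
    (hsolb : ∀ t ∈ Icc (0:ℝ) T, ∀ x,
      deriv (fun s => ρb.1 s x) t + ∑ i, u t x i * spd i (ρb.1 t) x
        = (κ₀ + κ₁) * lapl (ρb.1 t) x)
    (hε : τ * μ < 1 / 2)
    (hA2 : ∀ n : ℕ, n ≤ N → ∀ m : ℕ, m ≤ n → ∀ t ∈ Icc (0:ℝ) T, ∀ x,
      ‖iteratedFDeriv ℝ (m+1) (u t) x‖ ^ 2 ≤ CN * (μ / (κ₀ + κ₁)) ^ n * μ ^ 2)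
    (hA3 : ∀ n : ℕ, 1 ≤ n → n ≤ N →
      HnormSq n ρin ≤ CN * (μ / (κ₀ + κ₁)) ^ n * ((κ₀ + κ₁) * II T (N1 ρb)))
    (hA4 : ∀ n : ℕ, 1 ≤ n → n ≤ N → ∀ t ∈ Icc (0:ℝ) T, ∀ x s,
      ‖iteratedFDeriv ℝ n (fun y => P.η t y s) x‖
        ≤ CN * (τ * μ)^2 * (μ / (κ₀ + κ₁)) ^ ((n:ℝ)/2))
    (hA4' : ∀ t ∈ Icc (0:ℝ) T, ∀ x s,
      |deriv (fun t' => P.η t' x s) t + ∑ i, u t x i * spd i (fun y => P.η t y s) x|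
        ≤ CN * μ) :
    ∃ d : Data (9 * CN + K + 1), d.T = T ∧ d.κ₀ = κ₀ ∧ d.κ₁ = κ₁ ∧ d.τ = τ ∧ d.μ = μ ∧
      d.ρ = ρ ∧ d.ρb = ρb ∧ d.e = P.e τ⁻¹ := by
  have hq : 0 < κ₀ + κ₁ := by linarith
  set m : ℝ := √(μ / (κ₀ + κ₁)) with hm
  have hm0 : 0 < m := Real.sqrt_pos.2 (by positivity)
  have hm2 : μ / (κ₀ + κ₁) = m ^ 2 := (Real.sq_sqrt (by positivity)).symm
  have hε0 : 0 < τ * μ := by positivity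
  have hε1 : (τ * μ) ^ 2 ≤ 1 := by nlinarith
  have hμm : μ = m ^ 2 * (κ₀ + κ₁) := by rw [← hm2]; field_simp
  set L : ℝ := 9 * CN + K + 1 with hL
  have hCL : CN ≤ L := by linarith
  have hη1 : ∀ t ∈ Icc (0:ℝ) T, ∀ x s i, |spd i (fun y => P.η t y s) x| ≤ L * m := by
    intro t ht x s i
    refine (abs_spd_le _ _ _).trans ((hA4 1 le_rfl (by omega) t ht x s).trans ?_)
    rw [show (μ / (κ₀ + κ₁)) ^ (((1:ℕ):ℝ)/2) = m by rw [hm, Real.sqrt_eq_rpow]; norm_num]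
    gcongr
    nlinarith
  have hη2' : ∀ t ∈ Icc (0:ℝ) T, ∀ x s i j,
      |spd i (spd j (fun y => P.η t y s)) x| ≤ CN * m ^ 2 := by
    intro t ht x s i j
    refine (abs_spd_spd_le (P.contDiff_slice t s) _ _ _).trans
      ((hA4 2 (by norm_num) hN t ht x s).trans ?_)
    rw [show (μ / (κ₀ + κ₁)) ^ (((2:ℕ):ℝ)/2) = m ^ 2 by rw [← hm2]; norm_num]
    gcongr
    nlinarith
  have hη2 : ∀ t ∈ Icc (0:ℝ) T, ∀ x s i j,
      |spd i (spd j (fun y => P.η t y s)) x| ≤ L * m ^ 2 := fun t ht x s i j =>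
    (hη2' t ht x s i j).trans (by gcongr)
  have hv : ∀ t, ContDiff ℝ (⊤ : ℕ∞) (u t) := fun t => hu.comp (contDiff_prodMk_right t)
  set U := components u hu hup with hU
  have hUd : ∑ j, pd j (U j) = 0 := ext_ev fun t x => by
    rw [map_sum, map_zero, ← hdiv t x]
    exact Finset.sum_congr rfl fun i _ => (spd_eq_ev i (U i) t x).symm
  refine ⟨{ T := T, κ₀ := κ₀, κ₁ := κ₁, τ := τ, μ := μ, m := m, e := P.e τ⁻¹, θ := P.θ τ⁻¹,
            S := Dm U (P.θ τ⁻¹) - cst τ⁻¹ * (P.e τ⁻¹ - 1), ρ := ρ, ρb := ρb, u := U,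
            one_le := by linarith, T_pos := hT, κ₀_pos := hκ₀, κ_lt := hκ, τ_pos := hτ,
            m_pos := hm0, μ_eq := hμm, ε_le := by linarith, div_u := hUd, sol := ?_, solb := ?_,
            Dm_θ := by ring, θ_zero := ?_, init_eq := fun x => (hρ0 x).trans (hρb0 x).symm,
            e_nonneg := fun t _ x => P.nonneg t x _,
            e_le := fun t _ x => (hηK t x _).trans (by linarith), de_sq := ?_,
            de_le := ?_, dde_le := ?_, θ_le := fun t _ x => P.abs_θ_le _ t x,
            dθ_le := fun t ht x i => P.abs_pd_θ_le _ fun r => hη1 t ht x r i,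
            ddθ_le := fun t ht x i j => P.abs_pd_pd_θ_le _ fun r => hη2 t ht x r i j,
            S_le := fun t ht x => (P.abs_Dm_θ_sub_le _ U fun r => hA4' t ht x r).trans (by gcongr),
            du_le := ?_, ddu_le := ?_, init_one := ?_, init_two := ?_ },
    rfl, rfl, rfl, rfl, rfl, rfl, rfl, rfl⟩
  · intro t ht x
    rw [← deriv_add_eq_ev_Dm, add_zero, map_sum]
    refine (hsol t ht x).trans (Finset.sum_congr rfl fun i _ => ?_)
    rw [← spd_eq_ev]
    congr 1
    funext y
    rw [spd_eq_ev]
    rfl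
  · intro t ht x
    rw [← deriv_add_eq_ev_Dm, add_zero, map_sum]
    refine (hsolb t ht x).trans ?_
    rw [lapl, Finset.mul_sum]
    refine Finset.sum_congr rfl fun i _ => ?_
    change _ = ev t x (pd i (cst (κ₀ + κ₁) * pd i ρb))
    rw [spd_spd_eq_ev, Derivation.leibniz, pd_cst, smul_zero, add_zero, smul_eq_mul, map_mul, ev_cst]
  · intro x
    change prim P.osc ((0, x), τ⁻¹ * 0) = 0
    simp [prim]
  · intro t ht x i
    rw [← spd_eq_ev]
    refine (sq_spd_le_of_nonneg (contDiff_slice (P.e τ⁻¹) t) (fun y => P.nonneg t y _)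
      (fun y => (le_abs_self _).trans (hη2' t ht y (τ⁻¹ * t) i i)) x).trans ?_
    have h1 : 0 ≤ ev t x (P.e τ⁻¹) := P.nonneg t x _
    change 2 * (CN * m ^ 2) * ev t x (P.e τ⁻¹) ≤ _
    rw [← mul_assoc]
    gcongr
    linarith
  · intro t ht x i
    rw [← spd_eq_ev]
    exact hη1 t ht x (τ⁻¹ * t) i
  · intro t ht x i j
    rw [← spd_spd_eq_ev]
    exact hη2 t ht x (τ⁻¹ * t) i j
  · intro t ht x i j
    rw [← spd_eq_ev]
    refine ((abs_spd_le _ _ _).trans (norm_iteratedFDeriv_apply_le (hv t) 1 x j)).trans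
      ((hμu t ht x).trans ?_)
    nlinarith
  · intro t ht x i j l
    rw [← spd_spd_eq_ev]
    refine ((abs_spd_spd_le (contDiff_slice (U l) t) x i j).trans
      (norm_iteratedFDeriv_apply_le (hv t) 2 x l)).trans ?_
    refine abs_le_of_sq_le_sq' ?_ (by positivity) |>.2
    refine (hA2 1 (by omega) 1 le_rfl t ht x).trans ?_
    rw [hm2, pow_one, mul_pow, mul_pow]
    gcongr
    nlinarith
  · have h0 : ρb.1 0 = ρin := funext hρb0
    refine (Int3_N1_le ρb 0).trans ?_
    have h := hA3 1 le_rfl (by omega)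
    rw [hm2, pow_one] at h
    rw [h0]
    have hD : 0 ≤ m ^ 2 * ((κ₀ + κ₁) * II T (N1 ρb)) := by
      have := II_nonneg hT.le fun s _ x => N1_nonneg s x ρb
      positivity
    nlinarith [mul_nonneg hK.le hD]
  · have h0 : ρb.1 0 = ρin := funext hρb0
    refine (Int3_N2_le ρb 0).trans ?_
    have h := hA3 2 (by norm_num) hN
    rw [hm2, ← pow_mul, show 2 * 2 = 4 from rfl] at h
    rw [h0]
    have hD : 0 ≤ m ^ 4 * ((κ₀ + κ₁) * II T (N1 ρb)) := by
      have := II_nonneg hT.le fun s _ x => N1_nonneg s x ρb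
      positivity
    nlinarith [mul_nonneg hK.le hD]

theorem time_averaging
    (N : ℕ) (CN : ℝ) (hCN : 0 < CN) (K : ℝ) (hK : 0 < K) :
    -- the constant C depends only on N, C_N and ‖η‖_{L∞} (here bounded by K)
    ∃ C : ℝ, 0 < C ∧
    ∀ T κ₀ κ₁ τ μ : ℝ, 0 < T → 0 < κ₀ → κ₀ < κ₁ → 0 < τ → 0 < μ →
    ∀ η : ℝ → E3 → ℝ → ℝ,
      ContDiff ℝ (⊤ : ℕ∞) (fun p : ℝ × E3 × ℝ => η p.1 p.2.1 p.2.2) →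
      (∀ t x s, 0 ≤ η t x s) → (∀ t s, SpacePeriodic (fun x => η t x s)) →
      (∀ t x s, η t x (s + 1) = η t x s) →
      (∀ t x, (∫ s in (0:ℝ)..1, η t x s) = 1) →
      (∀ t x s, η t x s ≤ K) →
    ∀ u : ℝ → E3 → E3, SmoothTS u → (∀ t, SpacePeriodic (u t)) →
      (∀ t x, divg (u t) x = 0) →
      -- μ ≥ ‖∇u‖_{L∞}
      (∀ t ∈ Icc (0:ℝ) T, ∀ x, ‖iteratedFDeriv ℝ 1 (u t) x‖ ≤ μ) →
    ∀ ρin : E3 → ℝ, ContDiff ℝ (⊤ : ℕ∞) ρin → SpacePeriodic ρin →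
    ∀ ρ ρb : ℝ → E3 → ℝ, SmoothTS ρ → SmoothTS ρb →
      (∀ t, SpacePeriodic (ρ t)) → (∀ t, SpacePeriodic (ρb t)) →
      (∀ x, ρ 0 x = ρin x) → (∀ x, ρb 0 x = ρin x) →
      -- ∂ₜρ + u·∇ρ = div(κ̃∇ρ),  κ̃(x,t) = κ₀ + κ₁ η(x,t,τ⁻¹t)
      (∀ t ∈ Icc (0:ℝ) T, ∀ x,
        deriv (fun s => ρ s x) t + ∑ i, u t x i * spd i (ρ t) x
          = ∑ i, spd i (fun y => (κ₀ + κ₁ * η t y (τ⁻¹ * t)) * spd i (ρ t) y) x) →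
      -- ∂ₜρ̄ + u·∇ρ̄ = κΔρ̄,  κ = κ₀ + κ₁
      (∀ t ∈ Icc (0:ℝ) T, ∀ x,
        deriv (fun s => ρb s x) t + ∑ i, u t x i * spd i (ρb t) x
          = (κ₀ + κ₁) * lapl (ρb t) x) →
    -- assumptions (A1)–(A4)
    (τ * μ < 1/2) → ((τ * μ) ^ (N - 1) * (κ₀ + κ₁) < κ₀) →
    (∀ n : ℕ, n ≤ N → ∀ m : ℕ, m ≤ n → ∀ t ∈ Icc (0:ℝ) T, ∀ x,
      ‖iteratedFDeriv ℝ (m+1) (u t) x‖ ^ 2 ≤ CN * (μ / (κ₀ + κ₁)) ^ n * μ ^ 2) →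
    (∀ n : ℕ, 1 ≤ n → n ≤ N →
      HnormSq n ρin ≤ CN * (μ / (κ₀ + κ₁)) ^ n *
        ((κ₀ + κ₁) * ∫ t in (0:ℝ)..T, ∫ x in cube 3, ∑ i, (spd i (ρb t) x)^2)) →
    (∀ n : ℕ, 1 ≤ n → n ≤ N → ∀ t ∈ Icc (0:ℝ) T, ∀ x s,
      ‖iteratedFDeriv ℝ n (fun y => η t y s) x‖
        ≤ CN * (τ * μ)^2 * (μ / (κ₀ + κ₁)) ^ ((n:ℝ)/2)) →
    (∀ t ∈ Icc (0:ℝ) T, ∀ x s,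
      |deriv (fun t' => η t' x s) t + ∑ i, u t x i * spd i (fun y => η t y s) x|
        ≤ CN * μ) →
    -- conclusions
    ((∀ t ∈ Icc (0:ℝ) T,
        L2sq (fun x => ρ t x - ρb t x)
          + (κ₀ + κ₁) * (∫ s in (0:ℝ)..T, ∫ x in cube 3,
              ∑ i, (spd i (ρ s) x - spd i (ρb s) x)^2)
        ≤ C * (τ * μ)^2 *
            ((κ₀ + κ₁) * ∫ t in (0:ℝ)..T, ∫ x in cube 3, ∑ i, (spd i (ρb t) x)^2)) ∧
      -- |D − D̃| ≤ C (τμ)(D + D̃)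
      |((κ₀ + κ₁) * ∫ t in (0:ℝ)..T, ∫ x in cube 3, ∑ i, (spd i (ρb t) x)^2)
          - (∫ t in (0:ℝ)..T, ∫ x in cube 3,
              (κ₀ + κ₁ * η t x (τ⁻¹ * t)) * ∑ i, (spd i (ρ t) x)^2)|
        ≤ C * (τ * μ) *
           (((κ₀ + κ₁) * ∫ t in (0:ℝ)..T, ∫ x in cube 3, ∑ i, (spd i (ρb t) x)^2)
            + ∫ t in (0:ℝ)..T, ∫ x in cube 3,
                (κ₀ + κ₁ * η t x (τ⁻¹ * t)) * ∑ i, (spd i (ρ t) x)^2)) := by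
  set L : ℝ := 9 * CN + K + 1 with hL
  set c : ℝ := (1 / (340 * L ^ 3)) ^ (N - 1) with hc
  set M : ℝ := 300000000 * L ^ 6 / c ^ 2 with hM
  have hL1 : 1 ≤ L := by linarith
  have hL0 : 0 < L := by linarith
  have hc0 : 0 < c := by positivity
  have hc1 : c ≤ 1 := pow_le_one₀ (by positivity) (by
    rw [div_le_one (by positivity)]
    linarith [one_le_pow₀ hL1 (n := 3)])
  have hM0 : 0 < M := by positivity
  refine ⟨(5 * M + 9000000 * L ^ 6) + (L + 2 * L * M + 58 * L ^ 2), by positivity, ?_⟩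
  intro T κ₀ κ₁ τ μ hT hκ₀ hκ hτ hμ η hη hη0 hηp hηs hηm hηK u hu hup hdiv hμu ρin _ _ ρ ρb
    hρ hρb hρp hρbp hρ0 hρb0 hsol hsolb hε hεκ hA2 hA3 hA4 hA4'
  have hN : 2 ≤ N := by
    by_contra hN
    rw [show N - 1 = 0 by omega] at hεκ
    linarith
  have hD : ∫ t in (0:ℝ)..T, ∫ x in cube 3, ∑ i, (spd i (ρb t) x) ^ 2
      = II T (N1 (⟨ρb, hρb, hρbp⟩ : SP)) := (II_N1_eq T ⟨ρb, hρb, hρbp⟩).symm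
  rw [hD] at hA3 ⊢
  obtain ⟨d, rfl, rfl, rfl, rfl, rfl, h1, h2, h3⟩ := exists_data hN hCN hK hT hκ₀ hκ hτ hμ
    ⟨η, hη, hη0, hηp, hηs, hηm⟩ hηK u hu hup hdiv hμu ρin ⟨ρ, hρ, hρp⟩ ⟨ρb, hρb, hρbp⟩ hρ0 hρb0
    hsol hsolb hε hA2 hA3 hA4 hA4'
  have hX : d.X ≤ M * d.ε ^ 2 * d.D := d.X_le hc0 hc1 fun h => by
    refine (mul_le_mul_of_nonneg_right ?_ d.κ_pos.le).trans hεκ.le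
    exact pow_le_pow_left₀ (by positivity) h.le _
  have hD0 := d.D_nonneg
  have hε0 : 0 < d.τ * d.μ := by positivity
  have hDt0 := d.Dt_nonneg
  have eD : (d.κ₀ + d.κ₁) * II d.T (N1 (⟨ρb, hρb, hρbp⟩ : SP)) = d.D := by rw [← h2]; rfl
  have eX : (d.κ₀ + d.κ₁) * (∫ s in (0:ℝ)..d.T, ∫ x in cube 3,
      ∑ i, (spd i (ρ s) x - spd i (ρb s) x) ^ 2) = d.X := by
    have hs : ∀ s x i, spd i (ρ s) x - spd i (ρb s) x = spd i (d.w.1 s) x := fun s x i => by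
      rw [spd_eq_ev, Data.w, map_sub, map_sub, h1, h2, ← spd_eq_ev, ← spd_eq_ev]
    simp only [hs]
    rw [← II_N1_eq]
    rfl
  have eDt : ∫ t in (0:ℝ)..d.T, ∫ x in cube 3,
      (d.κ₀ + d.κ₁ * η t x (d.τ⁻¹ * t)) * ∑ i, (spd i (ρ t) x) ^ 2 = d.Dt := by
    rw [Data.Dt, II_mul_N1_eq, Data.kt, h3, h1]
    rfl
  have eW : ∀ t, L2sq (fun x => ρ t x - ρb t x) = Int3 t (d.w * d.w) := fun t => by
    simp only [L2sq, sq]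
    rw [Data.w, h1, h2]
    rfl
  simp only [eD, eX, eDt, eW]
  constructor
  · intro t ht
    have hW := d.Int3_w_le ht
    change _ ≤ _ * d.ε ^ 2 * d.D
    have : 0 ≤ (L + 2 * L * M + 58 * L ^ 2) * d.ε ^ 2 * d.D := by positivity
    linarith
  · refine (d.abs_D_sub_Dt_le hX).trans ?_
    have hε0' : 0 ≤ d.ε := hε0.le
    have hA : 0 ≤ 5 * M + 9000000 * L ^ 6 := by positivity
    have hB : 0 ≤ L + 2 * L * M + 58 * L ^ 2 := by positivity
    exact mul_le_mul (mul_le_mul_of_nonneg_right (le_add_of_nonneg_left hA) hε0')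
      (le_add_of_nonneg_right hDt0) hD0 (mul_nonneg (add_nonneg hA hB) hε0')

end
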